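/- arXiv:1407.5636 — 2 statements merged into one kernel-verified Lean document; each statement's English description precedes it below -/
import Mathlib

section
/- If w ∈ S_n is vexillary (i.e., w avoids the pattern 2143), then the number of reduced words for w equals f^{λ(w)}, the number of standard Young tableaux of shape λ(w). -/
open scoped Classical


/-- The adjacent transposition `sᵢ ∈ S_n` swapping `i` and `i+1` (one-based),
for `i ∈ {1, …, n-1}`; junk value `1` otherwise. -/
def simpleRefl (n i : ℕ) : Equiv.Perm (Fin n) :=
  if h : 1 ≤ i ∧ i < n then Equiv.swap ⟨i - 1, by omega⟩ ⟨i, h.2⟩ else 1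

/-- The product `s_{i₁} ⋯ s_{i_m}` of the word `i₁ ⋯ i_m`. -/
def wordProd (n : ℕ) (l : List ℕ) : Equiv.Perm (Fin n) :=
  (l.map (simpleRefl n)).prod

/-- `l` is a word for `w`: letters in `{1, …, n-1}` and product `w`. -/
def IsWordFor (n : ℕ) (w : Equiv.Perm (Fin n)) (l : List ℕ) : Prop :=
  (∀ i ∈ l, 1 ≤ i ∧ i ≤ n - 1) ∧ wordProd n l = w

/-- `l` is a reduced word for `w`: a word for `w` of minimal length. -/
def IsReducedWordFor (n : ℕ) (w : Equiv.Perm (Fin n)) (l : List ℕ) : Prop :=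
  IsWordFor n w l ∧ ∀ l', IsWordFor n w l' → l.length ≤ l'.length

/-- The longest element `w₀ ∈ S_n`, `w₀(i) = n + 1 - i` in one-line notation. -/
def w₀ (n : ℕ) : Equiv.Perm (Fin n) := Fin.revPerm

/-- The number of positions of the word `l` supporting a commutation,
i.e. positions `k` with `|i_k - i_{k+1}| > 1`. -/
def commCount (l : List ℕ) : ℕ :=
  ((Finset.range (l.length - 1)).filter
    (fun k => 1 < |(l.getD k 0 : ℤ) - (l.getD (k+1) 0 : ℤ)|)).card

/-- The number of consecutive noncommuting pairs in the word `l`,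
i.e. positions `k` with `|i_k - i_{k+1}| = 1`. -/
def noncommCount (l : List ℕ) : ℕ :=
  ((Finset.range (l.length - 1)).filter
    (fun k => |(l.getD k 0 : ℤ) - (l.getD (k+1) 0 : ℤ)| = 1)).card

/-- The number of positions of `l` supporting a long braid move, i.e. positions `k`
with `(i_k, i_{k+1}, i_{k+2})` of the form `(i, i+1, i)` or `(i+1, i, i+1)`. -/
noncomputable def braidCount (l : List ℕ) : ℕ :=
  ((Finset.range (l.length - 2)).filter
    (fun k => ∃ i : ℕ,
      (l.getD k 0, l.getD (k+1) 0, l.getD (k+2) 0) = (i, i+1, i) ∨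
      (l.getD k 0, l.getD (k+1) 0, l.getD (k+2) 0) = (i+1, i, i+1))).card


/-- The cells of the Young diagram of the partition whose parts form the multiset `M`
(rows and columns zero-indexed; cell `(i, j)` is present iff column `j` has height `> i`,
i.e. iff row `i` of the weakly decreasing rearrangement of `M` has length `> j`). -/
def cellsOf (M : Multiset ℕ) : Set (ℕ × ℕ) :=
  {p | p.1 < (M.filter (fun m => p.2 < m)).card}

/-- `T` is a standard Young tableau of the shape with parts `M`: it vanishes off the
diagram, takes each value `1, …, |M|` exactly once on the diagram, and increases
along rows and down columns. -/
def IsSYT (M : Multiset ℕ) (T : ℕ × ℕ → ℕ) : Prop :=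
  (∀ p, p ∉ cellsOf M → T p = 0) ∧
  (∀ m, 1 ≤ m → m ≤ M.sum → ∃! p, p ∈ cellsOf M ∧ T p = m) ∧
  (∀ i j, (i, j + 1) ∈ cellsOf M → T (i, j) < T (i, j + 1)) ∧
  (∀ i j, (i + 1, j) ∈ cellsOf M → T (i, j) < T (i + 1, j))

/-- `f^λ`, the number of standard Young tableaux of the shape with parts `M`. -/
noncomputable def sytCount (M : Multiset ℕ) : ℕ := Nat.card {T // IsSYT M T}

/-- The partition `λ(w)`: the (weakly decreasing rearrangement of the) multiset of the
numbers `rᵢ = #{j < i : w(j) > w(i)}`, zero parts discarded. -/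
def shapeOf (n : ℕ) (w : Equiv.Perm (Fin n)) : Multiset ℕ :=
  (Multiset.ofList (List.ofFn (fun i : Fin n =>
    (Finset.univ.filter (fun j : Fin n => j < i ∧ w i < w j)).card))).filter
    (fun r => 0 < r)

/-- The staircase partition `δ_n = (n-1, n-2, …, 2, 1)`. -/
def staircase (n : ℕ) : Multiset ℕ :=
  Multiset.ofList ((List.range (n - 1)).map (fun i => i + 1))

/-- `w` is vexillary: it avoids the pattern 2143. -/
def Vexillary (n : ℕ) (w : Equiv.Perm (Fin n)) : Prop :=
  ¬ ∃ i₁ i₂ i₃ i₄ : Fin n, i₁ < i₂ ∧ i₂ < i₃ ∧ i₃ < i₄ ∧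
    w i₂ < w i₁ ∧ w i₁ < w i₄ ∧ w i₄ < w i₃

/-- Left descents. -/
noncomputable def leftDescents (M : ℤ) (w : Equiv.Perm ℤ) : Finset ℤ :=
  (Finset.Ico (-M) M).filter fun k => w⁻¹ (k + 1) < w⁻¹ k

noncomputable def redCount (M : ℤ) : ℕ → Equiv.Perm ℤ → ℕ
  | 0, w => if w = 1 then 1 else 0
  | m + 1, w => ∑ k ∈ leftDescents M w, redCount M m (Equiv.swap k (k + 1) * w)

def BruhatCover (w : Equiv.Perm ℤ) (p q : ℤ) : Prop :=
  p < q ∧ w p < w q ∧ ∀ x, p < x → x < q → ¬ (w p < w x ∧ w x < w q)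

def FixesOutside (M : ℤ) (w : Equiv.Perm ℤ) : Prop :=
  ∀ k, k ≤ -M ∨ M ≤ k → w k = k

lemma cover_descent_iff (v : Equiv.Perm ℤ) (p q k : ℤ)
    (h1 : ¬ (v p = k + 1 ∧ v q = k)) (h2 : ¬ (v p = k ∧ v q = k + 1)) :
    (BruhatCover v p q ∧ (v * Equiv.swap p q)⁻¹ (k + 1) < (v * Equiv.swap p q)⁻¹ k) ↔
      (v⁻¹ (k + 1) < v⁻¹ k ∧ BruhatCover (Equiv.swap k (k + 1) * v) p q) := by
  obtain ⟨P, hP⟩ : ∃ P, v P = k := v.surjective k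
  obtain ⟨Q, hQ⟩ : ∃ Q, v Q = k + 1 := v.surjective (k + 1)
  have eP : v⁻¹ k = P := by rw [← hP]; simp
  have eQ : v⁻¹ (k + 1) = Q := by rw [← hQ]; simp
  have hPQ : P ≠ Q := by rintro rfl; omega
  have hxP : ∀ x, v x = k → x = P := fun x h => v.injective (h.trans hP.symm)
  have hxQ : ∀ x, v x = k + 1 → x = Q := fun x h => v.injective (h.trans hQ.symm)
  simp only [BruhatCover, mul_inv_rev, Equiv.swap_inv, Equiv.Perm.mul_apply, eP, eQ,
    Equiv.swap_apply_def]
  constructor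
  · rintro ⟨⟨hpq, hv, hx⟩, hd⟩
    have := hx P
    have := hx Q
    refine ⟨by grind (splits := 20), hpq, by grind, ?_⟩
    intro x h h'
    have := hx x h h'
    grind (splits := 20)
  · rintro ⟨hd, hpq, hv, hx⟩
    have := hx P
    have := hx Q
    refine ⟨⟨hpq, by grind (splits := 20), ?_⟩, by grind⟩
    intro x h h'
    have := hx x h h'
    grind (splits := 20)

lemma swap_mul_mul_swap_of_adjacent (v : Equiv.Perm ℤ) (p q k : ℤ)
    (h : v p = k ∧ v q = k + 1 ∨ v p = k + 1 ∧ v q = k) :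
    Equiv.swap k (k + 1) * (v * Equiv.swap p q) = v := by
  have : Equiv.swap k (k + 1) = Equiv.swap (v p) (v q) := by
    rcases h with ⟨h, h'⟩ | ⟨h, h'⟩
    · rw [h, h']
    · rw [h, h', Equiv.swap_comm]
  rw [this, Equiv.swap_apply_apply]
  ext x
  simp

lemma cover_redCount_pointwise (M : ℤ) (m : ℕ) (v : Equiv.Perm ℤ) {p q : ℤ} (hpq : p < q) (k : ℤ) :
    (if BruhatCover v p q ∧ (v * Equiv.swap p q)⁻¹ (k + 1) < (v * Equiv.swap p q)⁻¹ k then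
        redCount M m (Equiv.swap k (k + 1) * (v * Equiv.swap p q)) else 0) +
      (if v p = k + 1 ∧ v q = k then redCount M m v else 0) =
    (if v⁻¹ (k + 1) < v⁻¹ k ∧ BruhatCover (Equiv.swap k (k + 1) * v) p q then
        redCount M m (Equiv.swap k (k + 1) * (v * Equiv.swap p q)) else 0) +
      (if v p = k ∧ v q = k + 1 then redCount M m v else 0) := by
  by_cases h1 : v p = k + 1 ∧ v q = k
  · rw [swap_mul_mul_swap_of_adjacent v p q k (Or.inr h1)]
    obtain ⟨hp, hq⟩ := h1
    have hP : v⁻¹ k = q := by rw [← hq]; simp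
    have hQ : v⁻¹ (k + 1) = p := by rw [← hp]; simp
    rw [if_neg, if_pos ⟨hp, hq⟩, if_pos, if_neg]
    · ring
    · omega
    · refine ⟨by rw [hP, hQ]; exact hpq, hpq, by simp [hp, hq], ?_⟩
      intro x h h'
      simp only [Equiv.Perm.mul_apply, hp, hq, Equiv.swap_apply_left, Equiv.swap_apply_right]
      omega
    · rintro ⟨⟨-, h, -⟩, -⟩
      omega
  · by_cases h2 : v p = k ∧ v q = k + 1
    · rw [swap_mul_mul_swap_of_adjacent v p q k (Or.inl h2)]
      obtain ⟨hp, hq⟩ := h2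
      have hP : v⁻¹ k = p := by rw [← hp]; simp
      have hQ : v⁻¹ (k + 1) = q := by rw [← hq]; simp
      rw [if_pos, if_neg h1, if_neg, if_pos ⟨hp, hq⟩]
      · ring
      · rw [hP, hQ]
        omega
      · refine ⟨⟨hpq, by omega, fun x _ _ => by omega⟩, ?_⟩
        rwa [mul_inv_rev, Equiv.Perm.mul_apply, Equiv.Perm.mul_apply, hP, hQ, Equiv.swap_inv,
          Equiv.swap_apply_left, Equiv.swap_apply_right]
    · rw [if_neg h1, if_neg h2]
      simp only [cover_descent_iff v p q k h1 h2]

lemma cover_redCount_succ (M : ℤ) (m : ℕ) (v : Equiv.Perm ℤ) {p q : ℤ} (hpq : p < q)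
    (hp : -M ≤ v p ∧ v p ≤ M) (hq : -M ≤ v q ∧ v q ≤ M) :
    (if BruhatCover v p q then redCount M (m + 1) (v * Equiv.swap p q) else 0) +
      (if v p = v q + 1 then redCount M m v else 0) =
    (∑ k ∈ leftDescents M v, if BruhatCover (Equiv.swap k (k + 1) * v) p q then
        redCount M m (Equiv.swap k (k + 1) * v * Equiv.swap p q) else 0) +
      (if v q = v p + 1 then redCount M m v else 0) := by
  have key := Finset.sum_congr rfl
    (fun k (_ : k ∈ Finset.Ico (-M) M) => cover_redCount_pointwise M m v hpq k)
  rw [Finset.sum_add_distrib, Finset.sum_add_distrib] at key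
  have e1 : ∑ k ∈ Finset.Ico (-M) M, (if v p = k + 1 ∧ v q = k then redCount M m v else 0) =
      if v p = v q + 1 then redCount M m v else 0 := by
    rw [Finset.sum_eq_single (v q)]
    · simp
    · intro b _ hb
      rw [if_neg (fun h => hb h.2.symm)]
    · intro h
      rw [if_neg]
      rintro ⟨h1, -⟩
      exact h (Finset.mem_Ico.2 (by omega))
  have e2 : ∑ k ∈ Finset.Ico (-M) M, (if v p = k ∧ v q = k + 1 then redCount M m v else 0) =
      if v q = v p + 1 then redCount M m v else 0 := by
    rw [Finset.sum_eq_single (v p)]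
    · simp
    · intro b _ hb
      rw [if_neg (fun h => hb h.1.symm)]
    · intro h
      rw [if_neg]
      rintro ⟨-, h1⟩
      exact h (Finset.mem_Ico.2 (by omega))
  rw [e1, e2] at key
  convert key using 2
  · split_ifs with h
    · simp [redCount, leftDescents, Finset.sum_filter, h]
    · simp [h]
  · simp only [leftDescents, Finset.sum_filter, ite_and, mul_assoc]

lemma FixesOutside.inv {M : ℤ} {w : Equiv.Perm ℤ} (h : FixesOutside M w) :
    FixesOutside M w⁻¹ := by
  intro k hk
  rw [Equiv.Perm.inv_eq_iff_eq, h k hk]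

lemma FixesOutside.apply_mem {M : ℤ} {w : Equiv.Perm ℤ} (h : FixesOutside M w) {k : ℤ}
    (hk : -M < k ∧ k < M) : -M < w k ∧ w k < M := by
  by_contra hc
  have h1 := h (w k) (by omega)
  have h2 := w.injective h1
  omega

lemma FixesOutside.swap_mul {M : ℤ} {w : Equiv.Perm ℤ} (h : FixesOutside M w) {k : ℤ}
    (hk : w⁻¹ (k + 1) < w⁻¹ k) : -M < k ∧ k + 1 < M ∧ FixesOutside M (Equiv.swap k (k + 1) * w) := by
  have h1 := h.inv k
  have h2 := h.inv (k + 1)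
  have h3 := h.inv.apply_mem (k := k)
  have h4 := h.inv.apply_mem (k := k + 1)
  have hb : -M < k ∧ k + 1 < M := by
    by_cases c1 : k ≤ -M ∨ M ≤ k <;> by_cases c2 : k + 1 ≤ -M ∨ M ≤ k + 1
    · have := h1 c1; have := h2 c2; omega
    · have := h1 c1; have := h4 (by omega); omega
    · have := h3 (by omega); have := h2 c2; omega
    · omega
  refine ⟨hb.1, hb.2, fun x hx => ?_⟩
  rw [Equiv.Perm.mul_apply, h x hx, Equiv.swap_apply_of_ne_of_ne] <;> omega

/-- The Lascoux–Schützenberger transition formula, for the numbers of reduced words. -/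
theorem transition (M : ℤ) (m : ℕ) (v : Equiv.Perm ℤ) (r : ℤ) (hv : FixesOutside M v)
    (hr : -M < r ∧ r < M) :
    ∑ i ∈ Finset.Ico (-M) r,
        (if BruhatCover v i r then redCount M m (v * Equiv.swap i r) else 0) =
      ∑ j ∈ Finset.Ioc r M,
        (if BruhatCover v r j then redCount M m (v * Equiv.swap r j) else 0) := by
  induction m generalizing v with
  | zero =>
    have key : ∀ p q, (if BruhatCover v p q then redCount M 0 (v * Equiv.swap p q) else 0) = 0 := by
      intro p q
      split_ifs with h
      · rw [redCount, if_neg]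
        intro h1
        have h2 := h.1
        have h3 := h.2.1
        rw [mul_eq_one_iff_eq_inv, Equiv.swap_inv] at h1
        rw [h1, Equiv.swap_apply_left, Equiv.swap_apply_right] at h3
        omega
      · rfl
    simp only [key, Finset.sum_const_zero]
  | succ m ih =>
    have hvr := hv.apply_mem hr
    have bd : ∀ x, -M ≤ x ∧ x ≤ M → -M ≤ v x ∧ v x ≤ M := by
      intro x hx
      by_cases h : -M < x ∧ x < M
      · have := hv.apply_mem h; omega
      · rw [hv x (by omega)]; exact hx
    have bdi : ∀ x, -M ≤ x ∧ x ≤ M → -M ≤ v⁻¹ x ∧ v⁻¹ x ≤ M := by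
      intro x hx
      by_cases h : -M < x ∧ x < M
      · have := hv.inv.apply_mem h; omega
      · rw [hv.inv x (by omega)]; exact hx
    have inv_ne : ∀ x, x ≠ v r → v⁻¹ x ≠ r := fun x hx h => hx (by rw [← h]; simp)
    have hiff : ∀ i x, v i = x ↔ i = v⁻¹ x := fun i x => by
      rw [eq_comm (a := i), Equiv.Perm.inv_eq_iff_eq, eq_comm]
    have sum_lt : ∀ x X, -M ≤ x ∧ x ≤ M →
        (∑ i ∈ Finset.Ico (-M) r, if v i = x then X else 0) = if v⁻¹ x < r then X else 0 := by
      intro x X hx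
      have := bdi x hx
      simp only [hiff, Finset.sum_ite_eq', Finset.mem_Ico]
      congr 1
      exact propext ⟨fun h => h.2, fun h => ⟨this.1, h⟩⟩
    have sum_gt : ∀ x X, -M ≤ x ∧ x ≤ M →
        (∑ i ∈ Finset.Ioc r M, if v i = x then X else 0) = if r < v⁻¹ x then X else 0 := by
      intro x X hx
      have := bdi x hx
      simp only [hiff, Finset.sum_ite_eq', Finset.mem_Ioc]
      congr 1
      exact propext ⟨fun h => h.1, fun h => ⟨h, this.2⟩⟩
    have hL := Finset.sum_congr rfl (fun i (hi : i ∈ Finset.Ico (-M) r) =>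
      cover_redCount_succ M m v (p := i) (q := r) (Finset.mem_Ico.1 hi).2
        (bd i (by have := Finset.mem_Ico.1 hi; omega)) (bd r (by omega)))
    have hR := Finset.sum_congr rfl (fun j (hj : j ∈ Finset.Ioc r M) =>
      cover_redCount_succ M m v (p := r) (q := j) (Finset.mem_Ioc.1 hj).1
        (bd r (by omega)) (bd j (by have := Finset.mem_Ioc.1 hj; omega)))
    have e1 : ∀ i, (v r = v i + 1) = (v i = v r - 1) := fun i => propext (by omega)
    rw [Finset.sum_add_distrib, Finset.sum_add_distrib, Finset.sum_comm] at hL hR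
    simp only [e1] at hL hR
    rw [sum_lt _ _ (by omega), sum_lt _ _ (by omega)] at hL
    rw [sum_gt _ _ (by omega), sum_gt _ _ (by omega)] at hR
    have hmid := Finset.sum_congr rfl (fun k (hk : k ∈ leftDescents M v) =>
      ih (Equiv.swap k (k + 1) * v) (hv.swap_mul (Finset.mem_filter.1 hk).2).2.2)
    have n1 := inv_ne (v r + 1) (by omega)
    have n2 := inv_ne (v r - 1) (by omega)
    split_ifs at hL hR <;> omega

/-- The number of inversions of `w` whose right end is the position `p`. -/
noncomputable def invCode (w : Equiv.Perm ℤ) (p : ℤ) : ℕ := {q : ℤ | q < p ∧ w p < w q}.ncard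

/-- The length of the `j`-th column of the diagram of `λ(w)`. -/
noncomputable def colHeight (w : Equiv.Perm ℤ) (j : ℕ) : ℕ := {p : ℤ | j < invCode w p}.ncard

def Avoids2143 (w : Equiv.Perm ℤ) : Prop :=
  ∀ p q x y, p < q → q < x → x < y → w q < w p → w p < w y → w y < w x → False

structure IsTransition (w : Equiv.Perm ℤ) (i r s : ℤ) : Prop where
  i_lt : i < r
  lt_s : r < s
  apply_i : w i < w s
  apply_s : w s < w r
  before : ∀ k, k < i → w k < w i ∨ w s < w k
  left : ∀ k, i < k → k < r → w s < w k
  right : ∀ k, r < k → k < s → w k < w s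
  after : ∀ k, s < k → w r < w k

lemma ncard_preimage_perm (σ : Equiv.Perm ℤ) (A : Set ℤ) : (σ ⁻¹' A).ncard = A.ncard := by
  rw [← Equiv.image_symm_eq_preimage, Set.ncard_image_of_injective _ σ.symm.injective]

lemma transition_apply (w : Equiv.Perm ℤ) {i r s : ℤ} (hir : i < r) (hrs : r < s) (x : ℤ) :
    (w * Equiv.swap r s * Equiv.swap i r) x =
      if x = i then w s else if x = r then w i else if x = s then w r else w x := by
  simp only [Equiv.Perm.mul_apply, Equiv.swap_apply_def]
  grind

namespace IsTransition

variable {w : Equiv.Perm ℤ} {i r s : ℤ}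

lemma invCode_eq (h : IsTransition w i r s) (p : ℤ) :
    invCode (w * Equiv.swap r s * Equiv.swap i r) p = invCode w (Equiv.swap r s p) := by
  obtain ⟨h1, h2, h3, h4, h5, h6, h7, h8⟩ := h
  have key : ∃ σ : Equiv.Perm ℤ, ∀ q, (q < p ∧
      (w * Equiv.swap r s * Equiv.swap i r) p < (w * Equiv.swap r s * Equiv.swap i r) q) ↔
      (σ q < Equiv.swap r s p ∧ w (Equiv.swap r s p) < w (σ q)) := by
    have hp5 := h5 p
    have hp6 := h6 p
    have hp7 := h7 p
    have hp8 := h8 p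
    have hinj : ∀ x y, w x = w y → x = y := fun x y h => w.injective h
    simp only [transition_apply w h1 h2]
    rcases lt_or_ge s p with c | c
    · refine ⟨Equiv.swap r s * Equiv.swap i r, fun q => ?_⟩
      simp only [Equiv.Perm.mul_apply, Equiv.swap_apply_def]
      grind (splits := 20)
    · by_cases c1 : r ≤ p ∧ p < s
      · refine ⟨Equiv.swap i r, fun q => ?_⟩
        have hq5 := h5 q
        have hq6 := h6 q
        have hq7 := h7 q
        simp only [Equiv.swap_apply_def]
        grind (splits := 20)
      · refine ⟨1, fun q => ?_⟩
        have hq5 := h5 q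
        have hq6 := h6 q
        have hq7 := h7 q
        simp only [Equiv.Perm.one_apply, Equiv.swap_apply_def]
        grind (splits := 20)
  obtain ⟨σ, hσ⟩ := key
  unfold invCode
  rw [← ncard_preimage_perm σ {q | q < Equiv.swap r s p ∧ w (Equiv.swap r s p) < w q}]
  congr 1
  ext q
  exact hσ q

lemma colHeight_eq (h : IsTransition w i r s) (j : ℕ) :
    colHeight (w * Equiv.swap r s * Equiv.swap i r) j = colHeight w j := by
  unfold colHeight
  simp only [h.invCode_eq]
  exact ncard_preimage_perm (Equiv.swap r s) {p | j < invCode w p}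

lemma strictMonoOn_Iic (h : IsTransition w i r s) {d : ℤ} (hd : d < r)
    (hw : StrictMonoOn w (Set.Iic d)) :
    StrictMonoOn (w * Equiv.swap r s * Equiv.swap i r) (Set.Iic d) := by
  obtain ⟨h1, h2, h3, h4, h5, h6, h7, h8⟩ := h
  intro x hx y hy hxy
  have := hw hx hy hxy
  have := h6 y
  simp only [transition_apply w h1 h2, Set.mem_Iic] at *
  grind

lemma strictMonoOn_Ioi (h : IsTransition w i r s)
    (hw : StrictMonoOn w (Set.Ioi r)) :
    StrictMonoOn (w * Equiv.swap r s * Equiv.swap i r) (Set.Ioi r) := by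
  obtain ⟨h1, h2, h3, h4, h5, h6, h7, h8⟩ := h
  intro x hx y hy hxy
  have := hw hx hy hxy
  have := h8 y
  simp only [transition_apply w h1 h2, Set.mem_Ioi] at *
  grind

lemma lt_apply (h : IsTransition w i r s) (k : ℤ) (hk : s ≤ k) :
    (w * Equiv.swap r s * Equiv.swap i r) r < (w * Equiv.swap r s * Equiv.swap i r) k := by
  obtain ⟨h1, h2, h3, h4, h5, h6, h7, h8⟩ := h
  have := h8 k
  simp only [transition_apply w h1 h2]
  grind

lemma avoids2143 (h : IsTransition w i r s) (hr : StrictMonoOn w (Set.Ioi r))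
    (hw : Avoids2143 w) : Avoids2143 (w * Equiv.swap r s * Equiv.swap i r) := by
  have hm := h.strictMonoOn_Ioi hr
  obtain ⟨h1, h2, h3, h4, h5, h6, h7, h8⟩ := h
  intro p q x y hpq hqx hxy g1 g2 g3
  have hxr : x ≤ r := by
    by_contra hc
    have := hm (Set.mem_Ioi.2 (by omega : r < x)) (Set.mem_Ioi.2 (by omega : r < y)) hxy
    omega
  simp only [transition_apply w h1 h2] at g1 g2 g3
  have A1 := hw p q i y
  have A2 := hw p q x i
  have A3 := hw p q r s
  have A4 := hw p q x s
  have A5 := hw p q x r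
  have A6 := hw p q x y
  have A7 := hw p q i x
  have A8 := hw p q r y
  have B5 := h5 p
  have B6 := h6 p
  have C5 := h5 q
  have C6 := h6 q
  have D5 := h5 x
  have D6 := h6 x
  have D7 := h7 x
  have E6 := h6 y
  have E7 := h7 y
  have E8 := h8 y
  clear hw h5 h6 h7 h8 hm hr
  grind (splits := 40)

end IsTransition

lemma FixesOutside.mono {M N : ℤ} {w : Equiv.Perm ℤ} (h : FixesOutside M w) (hMN : M ≤ N) :
    FixesOutside N w := fun k hk => h k (by omega)

lemma FixesOutside.mul {M : ℤ} {v w : Equiv.Perm ℤ} (hv : FixesOutside M v)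
    (hw : FixesOutside M w) : FixesOutside M (v * w) := fun k hk => by
  rw [Equiv.Perm.mul_apply, hw k hk, hv k hk]

lemma fixesOutside_swap {M a b : ℤ} (ha : -M < a ∧ a < M) (hb : -M < b ∧ b < M) :
    FixesOutside M (Equiv.swap a b) := fun k hk => by
  rw [Equiv.swap_apply_of_ne_of_ne] <;> omega

lemma FixesOutside.lt_of_inversion {M : ℤ} {w : Equiv.Perm ℤ} (h : FixesOutside M w) {r s : ℤ}
    (hrs : r < s) (hw : w s < w r) : -M < r ∧ s < M := by
  have h1 := h r
  have h2 := h s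
  have h3 := h.apply_mem (k := r)
  have h4 := h.apply_mem (k := s)
  omega

lemma redCount_eq_of_le {M N : ℤ} (hMN : M ≤ N) (m : ℕ) {w : Equiv.Perm ℤ}
    (h : FixesOutside M w) : redCount N m w = redCount M m w := by
  induction m generalizing w with
  | zero => rfl
  | succ m ih =>
    have hD : leftDescents N w = leftDescents M w := by
      ext k
      simp only [leftDescents, Finset.mem_filter, Finset.mem_Ico]
      constructor
      · rintro ⟨-, hk⟩
        have := h.swap_mul hk
        exact ⟨by omega, hk⟩
      · rintro ⟨h1, hk⟩
        exact ⟨by omega, hk⟩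
    simp only [redCount, hD]
    exact Finset.sum_congr rfl fun k hk => ih (h.swap_mul (Finset.mem_filter.1 hk).2).2.2

lemma exists_isTransition {M : ℤ} {w : Equiv.Perm ℤ} (h : FixesOutside M w) (hw : Avoids2143 w)
    {r s : ℤ} (hr : StrictMonoOn w (Set.Ioi r)) (hrs : r < s) (hsr : w s < w r)
    (hs : ∀ k, s < k → w r < w k) : ∃ i, -M ≤ i ∧ IsTransition w i r s := by
  have hM := h.lt_of_inversion hrs hsr
  have hws := h.apply_mem (k := s) (by omega)
  have hlow := h (-M) (by omega)
  obtain ⟨i, ⟨hi1, hi2⟩, hi⟩ := Int.exists_greatest_of_bdd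
    (P := fun k => k < r ∧ w k < w s) ⟨r, fun z hz => hz.1.le⟩ ⟨-M, by omega, by omega⟩
  have hinj : ∀ x y, w x = w y → x = y := fun x y h => w.injective h
  refine ⟨i, hi _ ⟨by omega, by omega⟩, hi1, hrs, hi2, hsr, ?_, ?_, ?_, hs⟩
  · intro k hk
    have := hw k i r s hk hi1 hrs
    have := hinj k i
    have := hinj k s
    grind
  · intro k hk hk'
    have := hi k
    have := hinj k s
    omega
  · intro k hk hk'
    exact hr hk (hrs) hk'

namespace IsTransition

variable {w : Equiv.Perm ℤ} {i r s : ℤ}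

lemma cover_left_iff (h : IsTransition w i r s) {k : ℤ} (hk : k < r) :
    BruhatCover (w * Equiv.swap r s) k r ↔ k = i := by
  obtain ⟨h1, h2, h3, h4, h5, h6, h7, h8⟩ := h
  have e : ∀ x, x < r → (w * Equiv.swap r s) x = w x := fun x hx => by
    rw [Equiv.Perm.mul_apply, Equiv.swap_apply_of_ne_of_ne] <;> omega
  have er : (w * Equiv.swap r s) r = w s := by simp
  unfold BruhatCover
  rw [e k hk, er]
  constructor
  · rintro ⟨-, g1, g2⟩
    have := g2 i
    rw [e i h1] at this
    have := h5 k
    have := h6 k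
    omega
  · rintro rfl
    refine ⟨h1, h3, fun x hx hx' => ?_⟩
    rw [e x hx']
    have := h6 x hx hx'
    omega

lemma cover_right_iff (h : IsTransition w i r s) {k : ℤ} (hk : r < k) :
    BruhatCover (w * Equiv.swap r s) r k ↔ k = s := by
  obtain ⟨h1, h2, h3, h4, h5, h6, h7, h8⟩ := h
  have e : ∀ x, r < x → x ≠ s → (w * Equiv.swap r s) x = w x := fun x hx hx' => by
    rw [Equiv.Perm.mul_apply, Equiv.swap_apply_of_ne_of_ne] <;> omega
  have er : (w * Equiv.swap r s) r = w s := by simp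
  have es : (w * Equiv.swap r s) s = w r := by simp
  unfold BruhatCover
  rw [er]
  constructor
  · rintro ⟨-, g1, g2⟩
    by_contra hne
    rw [e k hk hne] at g1 g2
    have := g2 s h2
    rw [es] at this
    have := h7 k hk
    have := h8 k
    omega
  · rintro rfl
    refine ⟨h2, by rw [es]; exact h4, fun x hx hx' => ?_⟩
    rw [e x hx (by omega)]
    have := h7 x hx hx'
    omega

lemma fixesOutside (h : IsTransition w i r s) {M : ℤ} (hw : FixesOutside M w) (hi : -M < i) :
    FixesOutside M (w * Equiv.swap r s * Equiv.swap i r) := by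
  have h1 := h.i_lt
  have h2 := h.lt_s
  have hM := hw.lt_of_inversion h.lt_s h.apply_s
  exact (hw.mul (fixesOutside_swap (by omega) (by omega))).mul
    (fixesOutside_swap (by omega) (by omega))

lemma redCount_eq (h : IsTransition w i r s) {M : ℤ} (hw : FixesOutside M w) (hi : -M < i)
    (m : ℕ) : redCount M m w = redCount M m (w * Equiv.swap r s * Equiv.swap i r) := by
  have h1 := h.i_lt
  have h2 := h.lt_s
  have hM := hw.lt_of_inversion h.lt_s h.apply_s
  have key := transition M m (w * Equiv.swap r s) r
    (hw.mul (fixesOutside_swap (by omega) (by omega))) (by omega)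
  rw [Finset.sum_congr rfl fun k hk => if_congr (h.cover_left_iff (Finset.mem_Ico.1 hk).2) rfl rfl,
    Finset.sum_congr rfl fun k hk => if_congr (h.cover_right_iff (Finset.mem_Ioc.1 hk).1) rfl rfl,
    Finset.sum_ite_eq', Finset.sum_ite_eq', if_pos (Finset.mem_Ico.2 (by omega)),
    if_pos (Finset.mem_Ioc.2 (by omega))] at key
  rw [key, mul_assoc, Equiv.swap_mul_self, mul_one]

end IsTransition

/-- Repeated transitions reduce a vexillary permutation to a Grassmannian one. -/
theorem exists_grassmannian {M : ℤ} {w : Equiv.Perm ℤ} {d : ℤ} (n e : ℕ)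
    (h : FixesOutside M w) (hw : Avoids2143 w) (hd : StrictMonoOn w (Set.Iic d))
    (hr : StrictMonoOn w (Set.Ioi (d + n))) (he : ∀ k, d + n + e < k → w (d + n) < w k) :
    ∃ N ≥ M, ∃ w', FixesOutside N w' ∧ StrictMonoOn w' (Set.Iic d) ∧
      StrictMonoOn w' (Set.Ioi d) ∧ (∀ m, redCount N m w' = redCount N m w) ∧
      ∀ j, colHeight w' j = colHeight w j := by
  induction n generalizing M w e with
  | zero => exact ⟨M, le_rfl, w, h, hd, by simpa using hr, fun _ => rfl, fun _ => rfl⟩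
  | succ n ihn =>
    induction e generalizing M w with
    | zero =>
      push_cast at *
      refine ihn (max M (w (d + n)) - (d + n)).toNat h hw hd ?_ fun k hk => ?_
      · intro x hx y hy hxy
        rw [Set.mem_Ioi] at hx hy
        rcases eq_or_ne x (d + (n + 1)) with rfl | hx'
        · exact he y (by omega)
        · exact hr (Set.mem_Ioi.2 (by omega)) (Set.mem_Ioi.2 (by omega)) hxy
      · rw [h k (by omega)]
        omega
    | succ e ihe =>
      by_cases hs : w (d + (n + 1 : ℕ)) < w (d + (n + 1 : ℕ) + (e + 1))
      · refine ihe h hw hd hr fun k hk => ?_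
        rcases eq_or_ne k (d + (n + 1 : ℕ) + (e + 1)) with rfl | hk'
        · exact hs
        · exact he k (by push_cast at *; omega)
      · have hne : w (d + (n + 1 : ℕ)) ≠ w (d + (n + 1 : ℕ) + (e + 1)) := fun hc => by
          have := w.injective hc
          omega
        obtain ⟨i, hi, ht⟩ := exists_isTransition h hw (r := d + (n + 1 : ℕ))
          (s := d + (n + 1 : ℕ) + (e + 1)) hr (by omega) (by omega) (by simpa [add_assoc] using he)
        have h' := h.mono (show M ≤ M + 1 by omega)
        obtain ⟨N, hN, w', g1, g2, g3, g4, g5⟩ := ihe (ht.fixesOutside h' (by omega))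
          (ht.avoids2143 hr hw) (ht.strictMonoOn_Iic (by omega) hd) (ht.strictMonoOn_Ioi hr)
          (fun k hk => ht.lt_apply k (by omega))
        refine ⟨N, by omega, w', g1, g2, g3, fun m => ?_, fun j => ?_⟩
        · rw [g4, redCount_eq_of_le hN m (ht.fixesOutside h' (by omega)),
            ← ht.redCount_eq h' (by omega), redCount_eq_of_le hN m h']
        · rw [g5, ht.colHeight_eq]

lemma lt_ncard_iff_of_initial {d : ℤ} {X : Set ℤ} (hX : X.Finite) (h1 : ∀ x ∈ X, d < x)
    (h2 : ∀ x ∈ X, ∀ y, d < y → y < x → y ∈ X) (i : ℕ) : i < X.ncard ↔ d + 1 + i ∈ X := by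
  constructor
  · intro hi
    by_contra hc
    have hsub : X ⊆ ↑(Finset.Ico (d + 1) (d + 1 + i)) := by
      intro x hx
      have := h1 x hx
      rw [Finset.coe_Ico, Set.mem_Ico]
      refine ⟨by omega, ?_⟩
      by_contra hge
      rcases eq_or_ne x (d + 1 + i) with rfl | hne
      · exact hc hx
      · exact hc (h2 x hx _ (by omega) (by omega))
    have := Set.ncard_le_ncard hsub (Finset.finite_toSet _)
    rw [Set.ncard_coe_finset, Int.card_Ico] at this
    omega
  · intro hi
    have hsub : ↑(Finset.Icc (d + 1) (d + 1 + i)) ⊆ X := by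
      intro x hx
      rw [Finset.coe_Icc, Set.mem_Icc] at hx
      rcases eq_or_ne x (d + 1 + i) with rfl | hne
      · exact hi
      · exact h2 _ hi x (by omega) (by omega)
    have := Set.ncard_le_ncard hsub hX
    rw [Set.ncard_coe_finset, Int.card_Icc] at this
    omega

lemma lt_ncard_iff_of_final {d : ℤ} {X : Set ℤ} (hX : X.Finite) (h1 : ∀ x ∈ X, x ≤ d)
    (h2 : ∀ x ∈ X, ∀ y, y ≤ d → x < y → y ∈ X) (j : ℕ) : j < X.ncard ↔ d - j ∈ X := by
  rw [← ncard_preimage_perm (Equiv.neg ℤ) X,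
    lt_ncard_iff_of_initial (d := -d - 1) (hX.preimage (Equiv.neg ℤ).injective.injOn)
      (fun x hx => by have := h1 _ hx; simp only [Equiv.neg_apply] at this; omega)
      (fun x hx y hy hyx => h2 _ hx _ (by simp only [Equiv.neg_apply]; omega)
        (by simp only [Equiv.neg_apply]; omega))]
  rw [Set.mem_preimage, Equiv.neg_apply]
  congr! 1
  omega

lemma FixesOutside.lt_invCode_iff {M d : ℤ} {w : Equiv.Perm ℤ} (h : FixesOutside M w)
    (hl : StrictMonoOn w (Set.Iic d)) (hr : StrictMonoOn w (Set.Ioi d)) (j : ℕ) (p : ℤ) :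
    j < invCode w p ↔ d < p ∧ w p < w (d - j) := by
  have hle : ∀ q, q < p → w p < w q → q ≤ d ∧ d < p := by
    intro q hq hw
    by_contra hc
    by_cases hd : p ≤ d
    · have := hl (Set.mem_Iic.2 (by omega : q ≤ d)) (Set.mem_Iic.2 hd) hq
      omega
    · have := hr (Set.mem_Ioi.2 (by omega : d < q)) (Set.mem_Ioi.2 (by omega : d < p)) hq
      omega
  unfold invCode
  rw [lt_ncard_iff_of_final (d := d)]
  · rw [Set.mem_ofPred_eq]
    constructor
    · rintro ⟨h1, h2⟩
      exact ⟨(hle _ h1 h2).2, h2⟩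
    · rintro ⟨h1, h2⟩
      exact ⟨by omega, h2⟩
  · exact (Set.finite_Ioo (-M) p).subset fun q hq => ⟨(h.lt_of_inversion hq.1 hq.2).1, hq.1⟩
  · exact fun q hq => (hle q hq.1 hq.2).1
  · intro q hq y hy hqy
    have := hle q hq.1 hq.2
    exact ⟨by omega, hq.2.trans (hl (Set.mem_Iic.2 this.1) (Set.mem_Iic.2 hy) hqy)⟩

lemma FixesOutside.lt_colHeight_iff {M d : ℤ} {w : Equiv.Perm ℤ} (h : FixesOutside M w)
    (hl : StrictMonoOn w (Set.Iic d)) (hr : StrictMonoOn w (Set.Ioi d)) (i j : ℕ) :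
    i < colHeight w j ↔ w (d + 1 + i) < w (d - j) := by
  unfold colHeight
  simp only [h.lt_invCode_iff hl hr]
  rw [lt_ncard_iff_of_initial (d := d)]
  · exact ⟨fun h => h.2, fun h => ⟨by omega, h⟩⟩
  · exact (Set.finite_Ioo d M).subset fun p hp =>
      ⟨hp.1, (h.lt_of_inversion (by have := hp.1; omega) hp.2).2⟩
  · exact fun p hp => hp.1
  · intro p hp y hy hyp
    exact ⟨hy, (hr (Set.mem_Ioi.2 hy) (Set.mem_Ioi.2 hp.1) hyp).trans hp.2⟩

/-- Standard fillings of an arbitrary set of cells with the numbers `1, …, N`. -/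
def IsStandardFilling (C : Set (ℕ × ℕ)) (N : ℕ) (T : ℕ × ℕ → ℕ) : Prop :=
  (∀ p, p ∉ C → T p = 0) ∧
  (∀ m, 1 ≤ m → m ≤ N → ∃! p, p ∈ C ∧ T p = m) ∧
  (∀ i j, (i, j + 1) ∈ C → T (i, j) < T (i, j + 1)) ∧
  (∀ i j, (i + 1, j) ∈ C → T (i, j) < T (i + 1, j))

lemma IsStandardFilling.le {C : Set (ℕ × ℕ)} {N : ℕ} {T : ℕ × ℕ → ℕ}
    (h : IsStandardFilling C N T) (hf : C.Finite) (hC : C.ncard = N) {p : ℕ × ℕ} (hp : p ∈ C) :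
    T p ≤ N := by
  have hex : ∀ m : Finset.Icc 1 N, ∃ p ∈ C, T p = m := fun m => by
    have hm := Finset.mem_Icc.1 m.2
    obtain ⟨p, hp, -⟩ := h.2.1 m hm.1 hm.2
    exact ⟨p, hp⟩
  choose g hgC hgT using hex
  have hinj : Function.Injective g := fun a b hab => Subtype.ext (by rw [← hgT a, ← hgT b, hab])
  have hcard : (Set.range g).ncard = N := by
    rw [← Set.image_univ, Set.ncard_image_of_injective _ hinj, Set.ncard_univ,
      Nat.card_eq_fintype_card, Fintype.card_coe, Nat.card_Icc, Nat.add_sub_cancel]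
  have heq : Set.range g = C :=
    Set.eq_of_subset_of_ncard_le (by rintro _ ⟨a, rfl⟩; exact hgC a) (by omega) hf
  rw [← heq] at hp
  obtain ⟨a, rfl⟩ := hp
  rw [hgT]
  exact (Finset.mem_Icc.1 a.2).2

/-- The cells of the diagram of a permutation with a unique descent at `d`. -/
def grassCells (d : ℤ) (w : Equiv.Perm ℤ) : Set (ℕ × ℕ) :=
  {p | w (d + 1 + p.1) < w (d - p.2)}

lemma FixesOutside.finite_grassCells {M : ℤ} {w : Equiv.Perm ℤ} (h : FixesOutside M w) (d : ℤ) :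
    (grassCells d w).Finite := by
  refine (((Finset.range (M - d).toNat) ×ˢ (Finset.range (M + d).toNat)).finite_toSet).subset ?_
  rintro ⟨i, j⟩ hp
  have := h.lt_of_inversion (r := d - j) (s := d + 1 + i) (by omega) hp
  rw [Finset.mem_coe, Finset.mem_product, Finset.mem_range, Finset.mem_range]
  omega

lemma IsStandardFilling.update {C : Set (ℕ × ℕ)} {N : ℕ} {T : ℕ × ℕ → ℕ} {c : ℕ × ℕ}
    (hf : C.Finite) (hC : C.ncard = N + 1) (hc : c ∈ C) (hc1 : (c.1, c.2 + 1) ∉ C)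
    (hc2 : (c.1 + 1, c.2) ∉ C) (h : IsStandardFilling (C \ {c}) N T) :
    IsStandardFilling C (N + 1) (Function.update T c (N + 1)) := by
  have hle : ∀ p, T p ≤ N := fun p => by
    by_cases hp : p ∈ C \ {c}
    · exact h.le (hf.subset Set.sdiff_subset)
        (by rw [Set.ncard_sdiff_singleton_of_mem hc]; omega) hp
    · rw [h.1 p hp]
      exact Nat.zero_le _
  refine ⟨fun p hp => ?_, fun m hm1 hm2 => ?_, fun i j hij => ?_, fun i j hij => ?_⟩
  · rw [Function.update_of_ne (by rintro rfl; exact hp hc)]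
    exact h.1 p fun h' => hp h'.1
  · rcases Nat.lt_or_ge N m with hm | hm
    · obtain rfl : m = N + 1 := by omega
      refine ⟨c, ⟨hc, Function.update_self ..⟩, ?_⟩
      rintro p ⟨-, hp⟩
      by_contra hne
      rw [Function.update_of_ne hne] at hp
      have := hle p
      omega
    · obtain ⟨p, ⟨hp1, hp2⟩, hp3⟩ := h.2.1 m hm1 hm
      refine ⟨p, ⟨hp1.1, by rwa [Function.update_of_ne hp1.2]⟩, ?_⟩
      rintro q ⟨hq1, hq2⟩
      have hqc : q ≠ c := by
        rintro rfl
        rw [Function.update_self] at hq2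
        omega
      rw [Function.update_of_ne hqc] at hq2
      exact hp3 q ⟨⟨hq1, hqc⟩, hq2⟩
  · have h1 : (i, j) ≠ c := by rintro rfl; exact hc1 hij
    rw [Function.update_of_ne h1]
    by_cases h2 : (i, j + 1) = c
    · rw [h2, Function.update_self]
      exact Nat.lt_succ_of_le (hle _)
    · rw [Function.update_of_ne h2]
      exact h.2.2.1 i j ⟨hij, h2⟩
  · have h1 : (i, j) ≠ c := by rintro rfl; exact hc2 hij
    rw [Function.update_of_ne h1]
    by_cases h2 : (i + 1, j) = c
    · rw [h2, Function.update_self]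
      exact Nat.lt_succ_of_le (hle _)
    · rw [Function.update_of_ne h2]
      exact h.2.2.2 i j ⟨hij, h2⟩

lemma IsStandardFilling.erase {C : Set (ℕ × ℕ)} {N : ℕ} {T : ℕ × ℕ → ℕ} {c : ℕ × ℕ}
    (hc : c ∈ C) (hT : T c = N + 1) (h : IsStandardFilling C (N + 1) T) :
    IsStandardFilling (C \ {c}) N (Function.update T c 0) := by
  have hupd : ∀ p, Function.update T c 0 p ≤ T p := fun p => by
    rcases eq_or_ne p c with rfl | hp
    · simp
    · rw [Function.update_of_ne hp]
  refine ⟨fun p hp => ?_, fun m hm1 hm2 => ?_, fun i j hij => ?_, fun i j hij => ?_⟩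
  · rcases eq_or_ne p c with rfl | hpc
    · simp
    · rw [Function.update_of_ne hpc]
      exact h.1 p fun h' => hp ⟨h', hpc⟩
  · obtain ⟨p, ⟨hp1, hp2⟩, hp3⟩ := h.2.1 m hm1 (by omega)
    have hpc : p ≠ c := by rintro rfl; omega
    refine ⟨p, ⟨⟨hp1, hpc⟩, by rwa [Function.update_of_ne hpc]⟩, ?_⟩
    rintro q ⟨hq1, hq2⟩
    rw [Function.update_of_ne hq1.2] at hq2
    exact hp3 q ⟨hq1.1, hq2⟩
  · rw [Function.update_of_ne hij.2]
    exact (hupd _).trans_lt (h.2.2.1 i j hij.1)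
  · rw [Function.update_of_ne hij.2]
    exact (hupd _).trans_lt (h.2.2.2 i j hij.1)

/-- The cell removed from the diagram when the values `k` and `k + 1` are exchanged. -/
def descentCell (d : ℤ) (w : Equiv.Perm ℤ) (k : ℤ) : ℕ × ℕ :=
  ((w⁻¹ k - d - 1).toNat, (d - w⁻¹ (k + 1)).toNat)

section Grassmannian

variable {M d : ℤ} {w : Equiv.Perm ℤ} {k : ℤ}

lemma descent_bounds (hl : StrictMonoOn w (Set.Iic d)) (hr : StrictMonoOn w (Set.Ioi d))
    (hk : w⁻¹ (k + 1) < w⁻¹ k) : w⁻¹ (k + 1) ≤ d ∧ d < w⁻¹ k := by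
  have e1 : w (w⁻¹ k) = k := by simp
  have e2 : w (w⁻¹ (k + 1)) = k + 1 := by simp
  by_contra hc
  by_cases hd : w⁻¹ k ≤ d
  · have := hl (Set.mem_Iic.2 (by omega)) (Set.mem_Iic.2 hd) hk
    omega
  · have := hr (Set.mem_Ioi.2 (by omega)) (Set.mem_Ioi.2 (by omega)) hk
    omega

lemma apply_descentCell (hl : StrictMonoOn w (Set.Iic d)) (hr : StrictMonoOn w (Set.Ioi d))
    (hk : w⁻¹ (k + 1) < w⁻¹ k) :
    w (d + 1 + (descentCell d w k).1) = k ∧ w (d - (descentCell d w k).2) = k + 1 := by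
  have := descent_bounds hl hr hk
  have h1 : d + 1 + ((descentCell d w k).1 : ℤ) = w⁻¹ k := by
    unfold descentCell
    simp only
    omega
  have h2 : d - ((descentCell d w k).2 : ℤ) = w⁻¹ (k + 1) := by
    unfold descentCell
    simp only
    omega
  rw [h1, h2]
  simp

lemma strictMonoOn_swap_mul {S : Set ℤ} (hS : StrictMonoOn w S)
    (h : ¬ (w⁻¹ k ∈ S ∧ w⁻¹ (k + 1) ∈ S)) :
    StrictMonoOn (Equiv.swap k (k + 1) * w : Equiv.Perm ℤ) S := by
  intro x hx y hy hxy
  have h1 := hS hx hy hxy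
  simp only [Equiv.Perm.mul_apply, Equiv.swap_apply_def]
  have h2 : ¬ (w x = k ∧ w y = k + 1) := by
    rintro ⟨rfl, h2⟩
    exact h ⟨by simpa using hx, by rw [← h2]; simpa using hy⟩
  split_ifs <;> omega

lemma grassCells_swap_mul (hl : StrictMonoOn w (Set.Iic d)) (hr : StrictMonoOn w (Set.Ioi d))
    (hk : w⁻¹ (k + 1) < w⁻¹ k) :
    grassCells d (Equiv.swap k (k + 1) * w) = grassCells d w \ {descentCell d w k} := by
  obtain ⟨h1, h2⟩ := apply_descentCell hl hr hk
  have hinj : ∀ x y, w x = w y → x = y := fun x y h => w.injective h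
  ext ⟨i, j⟩
  have g1 := hinj (d + 1 + i) (d - j)
  have g2 : w (d + 1 + i) = k ↔ i = (descentCell d w k).1 :=
    ⟨fun h => by have := hinj _ _ (h.trans h1.symm); omega, fun h => by rw [h, h1]⟩
  have g3 : w (d - j) = k + 1 ↔ j = (descentCell d w k).2 :=
    ⟨fun h => by have := hinj _ _ (h.trans h2.symm); omega, fun h => by rw [h, h2]⟩
  have g4 : w (d + 1 + i) ≠ k + 1 := fun h => by
    rw [← h2] at h
    have := hinj _ _ h
    omega
  have g5 : w (d - j) ≠ k := fun h => by
    rw [← h1] at h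
    have := hinj _ _ h
    omega
  simp only [grassCells, Set.mem_ofPred_eq, Set.mem_sdiff, Set.mem_singleton_iff, Prod.ext_iff,
    Equiv.Perm.mul_apply, Equiv.swap_apply_def, ← g2, ← g3]
  split_ifs <;> omega

lemma FixesOutside.eq_one_of_strictMono (h : FixesOutside M w) (hw : StrictMono w) : w = 1 := by
  ext k
  by_contra hc
  rw [Equiv.Perm.one_apply] at hc
  have h1 : ∀ n : ℕ, ∀ k, w k + n ≤ w (k + n) := by
    intro n k
    induction n with
    | zero => simp
    | succ n ih =>
      have := hw (show k + n < k + (n + 1 : ℕ) by push_cast; omega)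
      push_cast at *
      omega
  have hk : -M < k ∧ k < M := by
    by_contra hk
    exact hc (h k (by omega))
  have a1 := h1 (M - k).toNat k
  have a2 := h1 (k + M).toNat (-M)
  rw [show k + ((M - k).toNat : ℤ) = M by omega, h M (by omega)] at a1
  rw [show -M + ((k + M).toNat : ℤ) = k by omega, h (-M) (by omega)] at a2
  omega

lemma strictMono_of_grassCells_eq_empty (hl : StrictMonoOn w (Set.Iic d))
    (hr : StrictMonoOn w (Set.Ioi d)) (hC : grassCells d w = ∅) : StrictMono w := by
  intro x y hxy
  by_cases hx : d < x
  · exact hr (Set.mem_Ioi.2 hx) (Set.mem_Ioi.2 (by omega)) hxy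
  by_cases hy : y ≤ d
  · exact hl (Set.mem_Iic.2 (by omega)) (Set.mem_Iic.2 hy) hxy
  have hn : ((y - d - 1).toNat, (d - x).toNat) ∉ grassCells d w := by rw [hC]; simp
  simp only [grassCells, Set.mem_ofPred_eq, not_lt] at hn
  rw [show d + 1 + ((y - d - 1).toNat : ℤ) = y by omega,
    show d - ((d - x).toNat : ℤ) = x by omega] at hn
  exact lt_of_le_of_ne hn fun h => hxy.ne (w.injective h)

lemma exists_descentCell_eq (hl : StrictMonoOn w (Set.Iic d)) (hr : StrictMonoOn w (Set.Ioi d))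
    {c : ℕ × ℕ} (hc : c ∈ grassCells d w) (hc1 : (c.1, c.2 + 1) ∉ grassCells d w)
    (hc2 : (c.1 + 1, c.2) ∉ grassCells d w) :
    ∃ k, w⁻¹ (k + 1) < w⁻¹ k ∧ descentCell d w k = c := by
  obtain ⟨i, j⟩ := c
  simp only [grassCells, Set.mem_ofPred_eq, not_lt, Nat.cast_add, Nat.cast_one] at hc hc1 hc2
  have hadj : w (d - j) = w (d + 1 + i) + 1 := by
    by_contra hne
    set x := w⁻¹ (w (d + 1 + i) + 1) with hx
    have hwx : w x = w (d + 1 + i) + 1 := by simp [hx]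
    by_cases hxd : x ≤ d
    · have hlt : x < d - j := (hl.lt_iff_lt (Set.mem_Iic.2 hxd) (Set.mem_Iic.2 (by omega))).1
        (by omega)
      have := hl.monotoneOn (Set.mem_Iic.2 hxd)
        (Set.mem_Iic.2 (by omega : d - ((j : ℤ) + 1) ≤ d)) (by omega)
      omega
    · have hlt : d + 1 + i < x := (hr.lt_iff_lt (Set.mem_Ioi.2 (by omega))
        (Set.mem_Ioi.2 (by omega))).1 (by omega)
      have := hr.monotoneOn (Set.mem_Ioi.2 (by omega : d < d + 1 + ((i : ℤ) + 1)))
        (Set.mem_Ioi.2 (by omega)) (by omega : d + 1 + ((i : ℤ) + 1) ≤ x)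
      omega
  have e1 : w⁻¹ (w (d + 1 + i)) = d + 1 + i := by simp
  have e2 : w⁻¹ (w (d + 1 + i) + 1) = d - j := by rw [← hadj]; simp
  refine ⟨w (d + 1 + i), by rw [e1, e2]; omega, ?_⟩
  rw [descentCell, e1, e2, Prod.mk.injEq]
  omega

end Grassmannian

/-- Reduced words of Grassmannian permutations correspond to standard tableaux. -/
theorem exists_finset_standardFilling {M d : ℤ} (m : ℕ) (w : Equiv.Perm ℤ)
    (h : FixesOutside M w) (hl : StrictMonoOn w (Set.Iic d)) (hr : StrictMonoOn w (Set.Ioi d))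
    (hm : (grassCells d w).ncard = m) :
    ∃ F : Finset (ℕ × ℕ → ℕ), F.card = redCount M m w ∧
      ∀ T, T ∈ F ↔ IsStandardFilling (grassCells d w) m T := by
  induction m generalizing w with
  | zero =>
    have hC := (Set.ncard_eq_zero (h.finite_grassCells d)).1 hm
    have h1 := h.eq_one_of_strictMono (strictMono_of_grassCells_eq_empty hl hr hC)
    refine ⟨{0}, by simp [redCount, h1], fun T => ?_⟩
    rw [Finset.mem_singleton, hC]
    refine ⟨?_, fun hT => funext fun p => hT.1 p (Set.notMem_empty p)⟩
    rintro rfl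
    exact ⟨fun _ _ => rfl, fun m _ _ => by omega, fun _ _ h => h.elim, fun _ _ h => h.elim⟩
  | succ m ih =>
    have hf := h.finite_grassCells d
    have hcell : ∀ k, w⁻¹ (k + 1) < w⁻¹ k → descentCell d w k ∈ grassCells d w := by
      intro k hk
      obtain ⟨h1, h2⟩ := apply_descentCell hl hr hk
      rw [grassCells, Set.mem_ofPred_eq, h1, h2]
      omega
    have hrec : ∀ k, w⁻¹ (k + 1) < w⁻¹ k → ∃ F : Finset (ℕ × ℕ → ℕ),
        F.card = redCount M m (Equiv.swap k (k + 1) * w) ∧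
        ∀ T, T ∈ F ↔ IsStandardFilling (grassCells d w \ {descentCell d w k}) m T := by
      intro k hk
      have hb := descent_bounds hl hr hk
      rw [← grassCells_swap_mul hl hr hk]
      refine ih _ (h.swap_mul hk).2.2 (strictMonoOn_swap_mul hl ?_)
        (strictMonoOn_swap_mul hr ?_) ?_
      · rintro ⟨h1, -⟩
        exact absurd (Set.mem_Iic.1 h1) (by omega)
      · rintro ⟨-, h1⟩
        exact absurd (Set.mem_Ioi.1 h1) (by omega)
      · rw [grassCells_swap_mul hl hr hk, Set.ncard_sdiff_singleton_of_mem (hcell k hk)]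
        omega
    choose! F hFcard hF using hrec
    have hD : ∀ k ∈ leftDescents M w, w⁻¹ (k + 1) < w⁻¹ k := fun k hk => (Finset.mem_filter.1 hk).2
    refine ⟨(leftDescents M w).biUnion fun k =>
      (F k).image fun T => Function.update T (descentCell d w k) (m + 1), ?_, fun T => ?_⟩
    · rw [Finset.card_biUnion, redCount]
      · refine Finset.sum_congr rfl fun k hk => ?_
        rw [Finset.card_image_of_injOn, hFcard k (hD k hk)]
        intro T hT T' hT' heq
        have h0 := ((hF k (hD k hk) T).1 hT).1 (descentCell d w k) (by simp)
        have h0' := ((hF k (hD k hk) T').1 hT').1 (descentCell d w k) (by simp)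
        funext p
        rcases eq_or_ne p (descentCell d w k) with rfl | hp
        · rw [h0, h0']
        · have := congrFun heq p
          simpa only [Function.update_of_ne hp] using this
      · intro k hk k' hk' hne
        rw [Function.onFun, Finset.disjoint_left]
        intro T hT hT'
        obtain ⟨T1, hT1, rfl⟩ := Finset.mem_image.1 hT
        obtain ⟨T2, hT2, heq⟩ := Finset.mem_image.1 hT'
        have hcne : descentCell d w k ≠ descentCell d w k' := fun hc => by
          have a1 := (apply_descentCell hl hr (hD k hk)).1
          have a2 := (apply_descentCell hl hr (hD k' hk')).1
          rw [hc] at a1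
          omega
        have e := congrFun heq (descentCell d w k)
        simp only [Function.update_self, Function.update_of_ne hcne] at e
        have hT2 := (hF k' (hD k' hk') T2).1 hT2
        have := hT2.le (hf.subset Set.sdiff_subset)
          (by rw [Set.ncard_sdiff_singleton_of_mem (hcell k' (hD k' hk'))]; omega)
          (p := descentCell d w k) ⟨hcell k (hD k hk), hcne⟩
        omega
    · simp only [Finset.mem_biUnion, Finset.mem_image]
      constructor
      · rintro ⟨k, hk, T, hT, rfl⟩
        obtain ⟨a1, a2⟩ := apply_descentCell hl hr (hD k hk)
        refine ((hF k (hD k hk) T).1 hT).update hf hm (hcell k (hD k hk)) ?_ ?_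
        · simp only [grassCells, Set.mem_ofPred_eq, a1, Nat.cast_add, Nat.cast_one]
          have := hl (Set.mem_Iic.2 (by omega : d - (((descentCell d w k).2 : ℤ) + 1) ≤ d))
            (Set.mem_Iic.2 (by omega : d - ((descentCell d w k).2 : ℤ) ≤ d)) (by omega)
          omega
        · simp only [grassCells, Set.mem_ofPred_eq, a2, Nat.cast_add, Nat.cast_one]
          have := hr (Set.mem_Ioi.2 (by omega : d < d + 1 + ((descentCell d w k).1 : ℤ)))
            (Set.mem_Ioi.2 (by omega : d < d + 1 + (((descentCell d w k).1 : ℤ) + 1))) (by omega)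
          omega
      · intro hT
        obtain ⟨c, ⟨hc, hTc⟩, -⟩ := hT.2.1 (m + 1) (by omega) le_rfl
        obtain ⟨k, hk, rfl⟩ := exists_descentCell_eq hl hr hc
          (fun h' => by
            have := hT.le hf hm h'
            have := hT.2.2.1 _ _ h'
            simp only [Prod.mk.eta] at this
            omega)
          (fun h' => by
            have := hT.le hf hm h'
            have := hT.2.2.2 _ _ h'
            simp only [Prod.mk.eta] at this
            omega)
        have hb := h.swap_mul hk
        refine ⟨k, Finset.mem_filter.2 ⟨Finset.mem_Ico.2 (by omega), hk⟩,
          Function.update T (descentCell d w k) 0, (hF k hk _).2 (hT.erase hc hTc), ?_⟩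
        rw [Function.update_idem, ← hTc, Function.update_eq_self]

/-- Reduced words of a vexillary permutation of `ℤ` are equinumerous with standard tableaux. -/
theorem card_standardFilling_eq_redCount {M d : ℤ} {n m : ℕ} {w : Equiv.Perm ℤ}
    (h : FixesOutside M w) (hw : Avoids2143 w) (hl : StrictMonoOn w (Set.Iic d))
    (hr : StrictMonoOn w (Set.Ioi (d + n)))
    (hm : {p : ℕ × ℕ | p.1 < colHeight w p.2}.ncard = m) :
    Nat.card {T // IsStandardFilling {p : ℕ × ℕ | p.1 < colHeight w p.2} m T} =
      redCount M m w := by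
  obtain ⟨N, hN, w', h', hl', hr', hR, hcol⟩ := exists_grassmannian n
    (max M (w (d + n)) - (d + n)).toNat h hw hl hr (fun k hk => by rw [h k (by omega)]; omega)
  have hC : {p : ℕ × ℕ | p.1 < colHeight w p.2} = grassCells d w' := by
    ext p
    rw [Set.mem_ofPred_eq, ← hcol, h'.lt_colHeight_iff hl' hr']
    rfl
  rw [hC] at hm ⊢
  obtain ⟨F, hF, hmem⟩ := exists_finset_standardFilling m w' h' hl' hr' hm
  rw [Nat.subtype_card F hmem, hF, hR, redCount_eq_of_le hN m h]

/-- The pairs of positions forming an inversion. -/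
def inversionSet (w : Equiv.Perm ℤ) : Set (ℤ × ℤ) := {p | p.1 < p.2 ∧ w p.2 < w p.1}

lemma FixesOutside.finite_inversionSet {M : ℤ} {w : Equiv.Perm ℤ} (h : FixesOutside M w) :
    (inversionSet w).Finite := by
  refine ((Set.finite_Ioo (-M) M).prod (Set.finite_Ioo (-M) M)).subset ?_
  rintro ⟨p, q⟩ ⟨hpq, hw⟩
  have := h.lt_of_inversion hpq hw
  simp only at hpq
  exact ⟨⟨this.1, by simp only; omega⟩, ⟨by simp only; omega, this.2⟩⟩

lemma inversionSet_swap_mul {w : Equiv.Perm ℤ} {k : ℤ} (hk : w⁻¹ (k + 1) < w⁻¹ k) :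
    inversionSet (Equiv.swap k (k + 1) * w) = inversionSet w \ {(w⁻¹ (k + 1), w⁻¹ k)} := by
  ext ⟨p, q⟩
  have g1 : ∀ x y, w x = y ↔ x = w⁻¹ y := fun x y => by
    rw [eq_comm (a := x), Equiv.Perm.inv_eq_iff_eq, eq_comm]
  simp only [inversionSet, Set.mem_ofPred_eq, Set.mem_sdiff, Set.mem_singleton_iff, Prod.mk.injEq,
    Equiv.Perm.mul_apply, Equiv.swap_apply_def, ← g1]
  have h1 := g1 p k
  have h2 := g1 q k
  have h3 := g1 p (k + 1)
  have h4 := g1 q (k + 1)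
  have h5 : w p = w q → p = q := fun h => w.injective h
  split_ifs <;> omega

lemma ncard_inversionSet_swap_mul {M : ℤ} {w : Equiv.Perm ℤ} {k : ℤ} (h : FixesOutside M w)
    (hk : w⁻¹ (k + 1) < w⁻¹ k) :
    (inversionSet (Equiv.swap k (k + 1) * w)).ncard + 1 = (inversionSet w).ncard := by
  have hmem : (w⁻¹ (k + 1), w⁻¹ k) ∈ inversionSet w := ⟨hk, by simp⟩
  rw [inversionSet_swap_mul hk, Set.ncard_sdiff_singleton_add_one hmem h.finite_inversionSet]

lemma ncard_inversionSet_swap_mul_of_lt {M : ℤ} {w : Equiv.Perm ℤ} {k : ℤ} (h : FixesOutside M w)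
    (h1 : -M < k) (h2 : k + 1 < M) (hk : w⁻¹ k < w⁻¹ (k + 1)) :
    (inversionSet (Equiv.swap k (k + 1) * w)).ncard = (inversionSet w).ncard + 1 := by
  have := ncard_inversionSet_swap_mul (M := M) (w := Equiv.swap k (k + 1) * w) (k := k)
    ((fixesOutside_swap (by omega) (by omega)).mul h) (by simpa using hk)
  rw [← this, ← mul_assoc, Equiv.swap_mul_self, one_mul]

/-- The inclusion of `Fin n` into `ℤ`. -/
def finToInt (n : ℕ) : Fin n ↪ ℤ := ⟨fun i => (i : ℤ), fun i j h => by simpa [Fin.ext_iff] using h⟩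

/-- A permutation of `Fin n` as a permutation of `ℤ`. -/
noncomputable def toIntPerm {n : ℕ} (w : Equiv.Perm (Fin n)) : Equiv.Perm ℤ :=
  w.viaEmbedding (finToInt n)

section ToIntPerm

variable {n : ℕ} (w : Equiv.Perm (Fin n))

lemma toIntPerm_apply (i : Fin n) : toIntPerm w i = w i :=
  Equiv.Perm.viaEmbedding_apply w (finToInt n) i

lemma toIntPerm_apply_of_notMem {k : ℤ} (hk : k < 0 ∨ n ≤ k) : toIntPerm w k = k := by
  refine Equiv.Perm.viaEmbedding_apply_of_notMem w (finToInt n) k ?_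
  rintro ⟨i, rfl⟩
  have := i.2
  change ((i : ℕ) : ℤ) < 0 ∨ (n : ℤ) ≤ ((i : ℕ) : ℤ) at hk
  omega

lemma exists_fin_of_mem {k : ℤ} (h0 : 0 ≤ k) (hn : k < n) : ∃ i : Fin n, (i : ℤ) = k :=
  ⟨⟨k.toNat, by omega⟩, by simp [h0]⟩

lemma toIntPerm_mem {k : ℤ} (hk : 0 ≤ k ∧ k < n) : 0 ≤ toIntPerm w k ∧ toIntPerm w k < n := by
  obtain ⟨i, rfl⟩ := exists_fin_of_mem hk.1 hk.2
  rw [toIntPerm_apply]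
  have := (w i).2
  omega

lemma toIntPerm_inversion {p q : ℤ} (hpq : p < q) (hw : toIntPerm w q < toIntPerm w p) :
    0 ≤ p ∧ q < n := by
  have h1 := toIntPerm_mem w (k := p)
  have h2 := toIntPerm_mem w (k := q)
  have h3 := toIntPerm_apply_of_notMem w (k := p)
  have h4 := toIntPerm_apply_of_notMem w (k := q)
  omega

lemma fixesOutside_toIntPerm : FixesOutside (n + 1) (toIntPerm w) := fun k hk =>
  toIntPerm_apply_of_notMem w (by omega)

lemma toIntPerm_injective : Function.Injective (toIntPerm (n := n)) :=
  Equiv.Perm.viaEmbeddingHom_injective (finToInt n)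

lemma toIntPerm_one : toIntPerm (1 : Equiv.Perm (Fin n)) = 1 :=
  map_one (Equiv.Perm.viaEmbeddingHom (finToInt n))

lemma toIntPerm_mul (v : Equiv.Perm (Fin n)) : toIntPerm (v * w) = toIntPerm v * toIntPerm w :=
  map_mul (Equiv.Perm.viaEmbeddingHom (finToInt n)) v w

lemma toIntPerm_simpleRefl {a : ℕ} (ha : 1 ≤ a) (han : a < n) :
    toIntPerm (simpleRefl n a) = Equiv.swap (a - 1 : ℤ) (a - 1 + 1) := by
  rw [simpleRefl, dif_pos ⟨ha, han⟩]
  ext k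
  by_cases hk : 0 ≤ k ∧ k < n
  · obtain ⟨i, rfl⟩ := exists_fin_of_mem hk.1 hk.2
    rw [toIntPerm_apply, Equiv.swap_apply_def, Equiv.swap_apply_def]
    simp only [Fin.ext_iff]
    split_ifs <;> (try dsimp only) <;> omega
  · rw [toIntPerm_apply_of_notMem _ (by omega), Equiv.swap_apply_of_ne_of_ne] <;> omega

lemma simpleRefl_mul_self (a : ℕ) : simpleRefl n a * simpleRefl n a = 1 := by
  unfold simpleRefl
  split_ifs
  · exact Equiv.swap_mul_self _ _
  · rw [one_mul]

lemma isWordFor_nil : IsWordFor n w [] ↔ w = 1 := by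
  simp [IsWordFor, wordProd, eq_comm]

lemma isWordFor_cons (a : ℕ) (l : List ℕ) :
    IsWordFor n w (a :: l) ↔ (1 ≤ a ∧ a ≤ n - 1) ∧ IsWordFor n (simpleRefl n a * w) l := by
  have : wordProd n (a :: l) = w ↔ wordProd n l = simpleRefl n a * w := by
    have h1 : wordProd n (a :: l) = simpleRefl n a * wordProd n l := by simp [wordProd]
    rw [h1]
    constructor
    · rintro rfl
      rw [← mul_assoc, simpleRefl_mul_self, one_mul]
    · intro h
      rw [h, ← mul_assoc, simpleRefl_mul_self, one_mul]
  simp only [IsWordFor, this, List.forall_mem_cons, and_assoc]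

/-- The length of a permutation of `Fin n`. -/
noncomputable def permLength : ℕ := (inversionSet (toIntPerm w)).ncard

variable {w}

lemma descent_toIntPerm_bounds {k : ℤ}
    (hk : (toIntPerm w)⁻¹ (k + 1) < (toIntPerm w)⁻¹ k) : 0 ≤ k ∧ k + 1 < n := by
  have h1 := toIntPerm_inversion w hk (by simp)
  have h2 := toIntPerm_mem w (k := (toIntPerm w)⁻¹ (k + 1))
  have h3 := toIntPerm_mem w (k := (toIntPerm w)⁻¹ k)
  have e2 : toIntPerm w ((toIntPerm w)⁻¹ (k + 1)) = k + 1 := by simp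
  have e3 : toIntPerm w ((toIntPerm w)⁻¹ k) = k := by simp
  omega

lemma toIntPerm_simpleRefl_mul {k : ℤ} (h0 : 0 ≤ k) (hn : k + 1 < n) :
    toIntPerm (simpleRefl n (k.toNat + 1) * w) = Equiv.swap k (k + 1) * toIntPerm w := by
  rw [toIntPerm_mul, toIntPerm_simpleRefl (by omega) (by omega)]
  congr 2 <;> push_cast <;> omega

lemma permLength_simpleRefl_mul {k : ℤ}
    (hk : (toIntPerm w)⁻¹ (k + 1) < (toIntPerm w)⁻¹ k) :
    permLength (simpleRefl n (k.toNat + 1) * w) + 1 = permLength w := by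
  have := descent_toIntPerm_bounds hk
  rw [permLength, toIntPerm_simpleRefl_mul this.1 this.2]
  exact ncard_inversionSet_swap_mul (fixesOutside_toIntPerm w) hk

lemma exists_descent (hw : w ≠ 1) : ∃ k, (toIntPerm w)⁻¹ (k + 1) < (toIntPerm w)⁻¹ k := by
  by_contra! hc
  refine hw (toIntPerm_injective ?_)
  rw [toIntPerm_one, ← inv_eq_one]
  refine (fixesOutside_toIntPerm w).inv.eq_one_of_strictMono (strictMono_int_of_lt_succ fun k => ?_)
  exact lt_of_le_of_ne (hc k) fun h => by
    have := (toIntPerm w)⁻¹.injective h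
    omega

lemma permLength_one : permLength (1 : Equiv.Perm (Fin n)) = 0 := by
  rw [permLength, toIntPerm_one, inversionSet]
  convert Set.ncard_empty (ℤ × ℤ)
  ext p
  simp only [Equiv.Perm.one_apply, Set.mem_ofPred_eq, Set.mem_empty_iff_false, iff_false]
  omega

lemma eq_one_of_permLength_eq_zero (hw : permLength w = 0) : w = 1 := by
  by_contra hc
  obtain ⟨k, hk⟩ := exists_descent hc
  have := permLength_simpleRefl_mul hk
  omega

lemma permLength_le_simpleRefl_mul {a : ℕ} (ha : 1 ≤ a) (han : a ≤ n - 1) :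
    permLength w ≤ permLength (simpleRefl n a * w) + 1 := by
  rcases lt_or_ge ((toIntPerm w)⁻¹ (((a - 1 : ℕ) : ℤ) + 1)) ((toIntPerm w)⁻¹ ((a - 1 : ℕ) : ℤ))
    with hk | hk
  · have := permLength_simpleRefl_mul hk
    rw [Int.toNat_natCast, Nat.sub_add_cancel ha] at this
    exact this.ge
  · have hk' := lt_of_le_of_ne hk fun h => by
      have := (toIntPerm w)⁻¹.injective h
      omega
    have := ncard_inversionSet_swap_mul_of_lt (fixesOutside_toIntPerm w) (by omega) (by omega) hk'
    rw [← toIntPerm_simpleRefl_mul (by omega) (by omega), Int.toNat_natCast,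
      Nat.sub_add_cancel ha] at this
    unfold permLength
    omega

lemma permLength_le_of_isWordFor {l : List ℕ} (h : IsWordFor n w l) :
    permLength w ≤ l.length := by
  induction l generalizing w with
  | nil =>
    rw [isWordFor_nil] at h
    rw [h, permLength_one, List.length_nil]
  | cons a l ih =>
    rw [isWordFor_cons] at h
    have h1 := permLength_le_simpleRefl_mul (w := w) h.1.1 h.1.2
    have h2 := ih h.2
    rw [List.length_cons]
    omega

lemma exists_isWordFor (w : Equiv.Perm (Fin n)) :
    ∃ l, IsWordFor n w l ∧ l.length = permLength w := by
  induction hm : permLength w generalizing w with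
  | zero =>
    exact ⟨[], (isWordFor_nil w).2 (eq_one_of_permLength_eq_zero hm), rfl⟩
  | succ m ih =>
    have hw : w ≠ 1 := by
      rintro rfl
      rw [permLength_one] at hm
      omega
    obtain ⟨k, hk⟩ := exists_descent hw
    have h1 := permLength_simpleRefl_mul hk
    have h2 := descent_toIntPerm_bounds hk
    obtain ⟨l, hl, hlen⟩ := ih (simpleRefl n (k.toNat + 1) * w) (by omega)
    exact ⟨(k.toNat + 1) :: l, (isWordFor_cons ..).2 ⟨by omega, hl⟩, by simp [hlen]⟩

lemma isReducedWordFor_iff (l : List ℕ) :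
    IsReducedWordFor n w l ↔ IsWordFor n w l ∧ l.length = permLength w := by
  constructor
  · rintro ⟨h, hmin⟩
    obtain ⟨l', hl', hlen⟩ := exists_isWordFor w
    exact ⟨h, le_antisymm (hlen ▸ hmin l' hl') (permLength_le_of_isWordFor h)⟩
  · rintro ⟨h, hlen⟩
    exact ⟨h, fun l' hl' => hlen ▸ permLength_le_of_isWordFor hl'⟩

lemma exists_finset_words (m : ℕ) (w : Equiv.Perm (Fin n)) (hm : permLength w = m) :
    ∃ F : Finset (List ℕ), F.card = redCount (n + 1) m (toIntPerm w) ∧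
      ∀ l, l ∈ F ↔ IsWordFor n w l ∧ l.length = m := by
  induction m generalizing w with
  | zero =>
    have hw := eq_one_of_permLength_eq_zero hm
    refine ⟨{[]}, by simp [redCount, hw, toIntPerm_one], fun l => ?_⟩
    rw [Finset.mem_singleton, List.length_eq_zero_iff]
    exact ⟨fun h => ⟨h ▸ (isWordFor_nil w).2 hw, h⟩, fun h => h.2⟩
  | succ m ih =>
    have hrec : ∀ k : ℤ, (toIntPerm w)⁻¹ (k + 1) < (toIntPerm w)⁻¹ k → ∃ F : Finset (List ℕ),
        F.card = redCount (n + 1) m (Equiv.swap k (k + 1) * toIntPerm w) ∧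
        ∀ l, l ∈ F ↔ IsWordFor n (simpleRefl n (k.toNat + 1) * w) l ∧ l.length = m := by
      intro k hk
      have h1 := permLength_simpleRefl_mul hk
      have h2 := descent_toIntPerm_bounds hk
      rw [← toIntPerm_simpleRefl_mul h2.1 h2.2]
      exact ih _ (by omega)
    choose! F hFcard hF using hrec
    have hD : ∀ k ∈ leftDescents (n + 1) (toIntPerm w),
        (toIntPerm w)⁻¹ (k + 1) < (toIntPerm w)⁻¹ k := fun k hk => (Finset.mem_filter.1 hk).2
    refine ⟨(leftDescents (n + 1) (toIntPerm w)).biUnion fun k =>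
      (F k).image (List.cons (k.toNat + 1)), ?_, fun l => ?_⟩
    · rw [Finset.card_biUnion, redCount]
      · refine Finset.sum_congr rfl fun k hk => ?_
        rw [Finset.card_image_of_injective _ List.cons_injective, hFcard k (hD k hk)]
      · intro k hk k' hk' hne
        rw [Function.onFun, Finset.disjoint_left]
        intro l hl hl'
        obtain ⟨l1, -, rfl⟩ := Finset.mem_image.1 hl
        obtain ⟨l2, -, heq⟩ := Finset.mem_image.1 hl'
        have h1 := descent_toIntPerm_bounds (hD k hk)
        have h2 := descent_toIntPerm_bounds (hD k' hk')
        have h3 := (List.cons.inj heq).1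
        omega
    · simp only [Finset.mem_biUnion, Finset.mem_image]
      constructor
      · rintro ⟨k, hk, l, hl, rfl⟩
        have h1 := (hF k (hD k hk) l).1 hl
        have h2 := descent_toIntPerm_bounds (hD k hk)
        exact ⟨(isWordFor_cons ..).2 ⟨by omega, h1.1⟩, by simp [h1.2]⟩
      · rintro ⟨hl, hlen⟩
        obtain _ | ⟨a, l⟩ := l
        · simp at hlen
        rw [isWordFor_cons] at hl
        rw [List.length_cons, Nat.add_right_cancel_iff] at hlen
        have ha : ((a - 1 : ℕ) : ℤ).toNat + 1 = a := by omega
        have hk : (toIntPerm w)⁻¹ (((a - 1 : ℕ) : ℤ) + 1) < (toIntPerm w)⁻¹ ((a - 1 : ℕ) : ℤ) := by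
          by_contra hge
          have hk' := lt_of_le_of_ne (not_lt.1 hge) fun h => by
            have := (toIntPerm w)⁻¹.injective h
            omega
          have h1 := ncard_inversionSet_swap_mul_of_lt (fixesOutside_toIntPerm w)
            (by omega) (by omega) hk'
          rw [← toIntPerm_simpleRefl_mul (by omega) (by omega), ha] at h1
          have h2 := permLength_le_of_isWordFor hl.2
          unfold permLength at h2 hm
          omega
        refine ⟨((a - 1 : ℕ) : ℤ), Finset.mem_filter.2 ⟨Finset.mem_Ico.2 (by omega), hk⟩, l, ?_, by
          rw [ha]⟩
        rw [hF _ hk, ha]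
        exact ⟨hl.2, hlen⟩

end ToIntPerm

section ToIntPerm

variable {n : ℕ} (w : Equiv.Perm (Fin n))

lemma strictMonoOn_toIntPerm_Iic : StrictMonoOn (toIntPerm w) (Set.Iic (-1)) := by
  intro p hp q hq hpq
  rw [Set.mem_Iic] at hp hq
  rwa [toIntPerm_apply_of_notMem w (by omega), toIntPerm_apply_of_notMem w (by omega)]

lemma strictMonoOn_toIntPerm_Ioi : StrictMonoOn (toIntPerm w) (Set.Ioi (-1 + n)) := by
  intro p hp q hq hpq
  rw [Set.mem_Ioi] at hp hq
  rwa [toIntPerm_apply_of_notMem w (by omega), toIntPerm_apply_of_notMem w (by omega)]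

lemma Vexillary.avoids2143_toIntPerm {w : Equiv.Perm (Fin n)} (hw : Vexillary n w) : Avoids2143 (toIntPerm w) := by
  intro p q x y hpq hqx hxy hqp hpy hyx
  have h1 := toIntPerm_inversion w hpq hqp
  have h2 := toIntPerm_inversion w hxy hyx
  obtain ⟨p, rfl⟩ := exists_fin_of_mem (n := n) (k := p) (by omega) (by omega)
  obtain ⟨q, rfl⟩ := exists_fin_of_mem (n := n) (k := q) (by omega) (by omega)
  obtain ⟨x, rfl⟩ := exists_fin_of_mem (n := n) (k := x) (by omega) (by omega)
  obtain ⟨y, rfl⟩ := exists_fin_of_mem (n := n) (k := y) (by omega) (by omega)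
  simp only [toIntPerm_apply] at hqp hpy hyx
  refine hw ⟨p, q, x, y, ?_, ?_, ?_, ?_, ?_, ?_⟩ <;> rw [Fin.lt_def] <;> omega

lemma invCode_toIntPerm (i : Fin n) : invCode (toIntPerm w) i =
    (Finset.univ.filter fun j : Fin n => j < i ∧ w i < w j).card := by
  rw [← Finset.card_map (finToInt n), ← Set.ncard_coe_finset, invCode]
  congr 1
  ext q
  simp only [Set.mem_ofPred_eq, Finset.coe_map, Set.mem_image, Finset.mem_coe, Finset.mem_filter,
    Finset.mem_univ, true_and]
  constructor
  · rintro ⟨hq, hw⟩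
    have h1 := toIntPerm_inversion w hq hw
    obtain ⟨q, rfl⟩ := exists_fin_of_mem (n := n) (k := q) (by omega) (by omega)
    simp only [toIntPerm_apply] at hw
    exact ⟨q, ⟨by rw [Fin.lt_def]; omega, by rw [Fin.lt_def]; omega⟩, rfl⟩
  · rintro ⟨j, ⟨h1, h2⟩, rfl⟩
    change (j : ℤ) < i ∧ toIntPerm w i < toIntPerm w j
    rw [toIntPerm_apply, toIntPerm_apply]
    rw [Fin.lt_def] at h1 h2
    omega

lemma mem_of_invCode_toIntPerm_pos {p : ℤ} (hp : 0 < invCode (toIntPerm w) p) :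
    0 ≤ p ∧ p < n := by
  obtain ⟨q, hq, hw⟩ := Set.nonempty_of_ncard_ne_zero hp.ne'
  have := toIntPerm_inversion w hq hw
  omega

lemma shapeOf_eq : shapeOf n w =
    (Finset.univ.val.map fun i : Fin n => invCode (toIntPerm w) i).filter (0 < ·) := by
  simp only [shapeOf, invCode_toIntPerm, Fin.univ_val_map]

lemma colHeight_toIntPerm (j : ℕ) :
    colHeight (toIntPerm w) j = ((shapeOf n w).filter (j < ·)).card := by
  have h : ((shapeOf n w).filter (j < ·)).card =
      (Finset.univ.filter fun i : Fin n => j < invCode (toIntPerm w) i).card := by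
    rw [shapeOf_eq, Multiset.filter_filter, Multiset.filter_map, Multiset.card_map,
      Finset.card, Finset.filter_val]
    congr 1
    refine Multiset.filter_congr fun i _ => ?_
    simp only [Function.comp_apply]
    omega
  rw [h, ← Finset.card_map (finToInt n), ← Set.ncard_coe_finset, colHeight]
  congr 1
  ext p
  simp only [Set.mem_ofPred_eq, Finset.coe_map, Set.mem_image, Finset.mem_coe, Finset.mem_filter,
    Finset.mem_univ, true_and]
  constructor
  · intro hp
    have h1 := mem_of_invCode_toIntPerm_pos w (p := p) (by omega)
    obtain ⟨i, rfl⟩ := exists_fin_of_mem (n := n) (k := p) (by omega) (by omega)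
    exact ⟨i, hp, rfl⟩
  · rintro ⟨i, hi, rfl⟩
    exact hi

lemma sum_shapeOf : (shapeOf n w).sum = permLength w := by
  have h1 : (shapeOf n w).sum = ∑ i : Fin n, invCode (toIntPerm w) i := by
    have h2 := Multiset.filter_add_not (0 < ·)
      (Finset.univ.val.map fun i : Fin n => invCode (toIntPerm w) i)
    rw [Finset.sum, ← h2, Multiset.sum_add, shapeOf_eq, left_eq_add]
    refine Multiset.sum_eq_zero fun x hx => ?_
    have := (Multiset.mem_filter.1 hx).2
    omega
  have h3 : permLength w = ((Finset.univ : Finset (Fin n)).sigma fun i =>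
      Finset.univ.filter fun j : Fin n => j < i ∧ w i < w j).card := by
    rw [permLength, ← Set.ncard_coe_finset]
    refine (Set.ncard_congr (fun x _ => ((x.2 : ℤ), (x.1 : ℤ))) ?_ ?_ ?_).symm
    · rintro ⟨i, j⟩ h
      simp only [Finset.coe_sigma, Set.mem_sigma_iff, Finset.mem_coe, Finset.mem_univ,
        Finset.mem_filter, true_and, Fin.lt_def] at h
      change (j : ℤ) < i ∧ toIntPerm w i < toIntPerm w j
      rw [toIntPerm_apply, toIntPerm_apply]
      omega
    · rintro ⟨i, j⟩ ⟨i', j'⟩ - - h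
      simp only [Prod.mk.injEq, Nat.cast_inj, Fin.val_inj] at h
      rw [h.1, h.2]
    · rintro ⟨p, q⟩ ⟨hpq, hw⟩
      have h1 := toIntPerm_inversion w hpq hw
      simp only at hpq
      obtain ⟨i, rfl⟩ := exists_fin_of_mem (n := n) (k := q) (by omega) (by omega)
      obtain ⟨j, rfl⟩ := exists_fin_of_mem (n := n) (k := p) (by omega) (by omega)
      simp only [toIntPerm_apply] at hw
      refine ⟨⟨i, j⟩, ?_, rfl⟩
      simp only [Finset.coe_sigma, Set.mem_sigma_iff, Finset.mem_coe, Finset.mem_univ,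
        Finset.mem_filter, true_and, Fin.lt_def]
      omega
  rw [h1, h3, Finset.card_sigma]
  simp only [invCode_toIntPerm]

end ToIntPerm

lemma cellsOf_finite_and_ncard (M : Multiset ℕ) :
    (cellsOf M).Finite ∧ (cellsOf M).ncard = M.sum := by
  induction M using Multiset.induction with
  | empty => simp [cellsOf]
  | cons a M ih =>
    have hdisj : Disjoint (cellsOf M)
        ((fun j => ((M.filter (fun m => j < m)).card, j)) '' Set.Iio a) := by
      rw [Set.disjoint_left]
      rintro p hp ⟨j, -, rfl⟩
      exact absurd hp (lt_irrefl (M.filter (fun m => j < m)).card)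
    have heq : cellsOf (a ::ₘ M) =
        cellsOf M ∪ (fun j => ((M.filter (fun m => j < m)).card, j)) '' Set.Iio a := by
      ext ⟨i, j⟩
      simp only [cellsOf, Set.mem_ofPred_eq, Multiset.filter_cons, Multiset.card_add, Set.mem_union,
        Set.mem_image, Set.mem_Iio, Prod.mk.injEq]
      constructor
      · intro h
        split_ifs at h with ha
        · rw [Multiset.card_singleton] at h
          by_cases hi : i < (M.filter (fun m => j < m)).card
          · exact Or.inl hi
          · exact Or.inr ⟨j, ha, by omega, rfl⟩
        · rw [Multiset.card_zero] at h
          exact Or.inl (by omega)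
      · rintro (h | ⟨j, ha, rfl, rfl⟩)
        · omega
        · rw [if_pos ha, Multiset.card_singleton]
          omega
    have hfin := (Set.finite_Iio a).image fun j => ((M.filter (fun m => j < m)).card, j)
    rw [heq, Set.ncard_union_eq hdisj ih.1 hfin, ih.2, Multiset.sum_cons,
      Set.ncard_image_of_injective _ fun j j' h => (Prod.mk.inj h).2,
      ← Finset.coe_Iio, Set.ncard_coe_finset, Nat.card_Iio, add_comm]
    exact ⟨ih.1.union (by simpa using hfin), rfl⟩

/-- Stanley's theorem: if `w ∈ S_n` is vexillary, then the number of reduced words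
for `w` equals `f^(λ(w))`, the number of standard Young tableaux of shape `λ(w)`. -/
theorem vexillary_reduced_word_count (n : ℕ) (w : Equiv.Perm (Fin n)) (hw : Vexillary n w) :
    Nat.card {l : List ℕ // IsReducedWordFor n w l} = sytCount (shapeOf n w) := by
  have hcells : cellsOf (shapeOf n w) = {p | p.1 < colHeight (toIntPerm w) p.2} := by
    ext p
    rw [Set.mem_ofPred_eq, colHeight_toIntPerm]
    rfl
  obtain ⟨F, hF, hmem⟩ := exists_finset_words (permLength w) w rfl
  rw [Nat.subtype_card F fun l => (hmem l).trans (isReducedWordFor_iff l).symm, hF,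
    ← card_standardFilling_eq_redCount (fixesOutside_toIntPerm w) hw.avoids2143_toIntPerm
      (strictMonoOn_toIntPerm_Iic w) (strictMonoOn_toIntPerm_Ioi w) (m := permLength w)
      (by rw [← hcells, (cellsOf_finite_and_ncard _).2, sum_shapeOf]),
    ← hcells, ← sum_shapeOf]
  rfl
end

section
/- For all n ≥ 3, with ℓ = n(n−1)/2, and every j ∈ {1,…,n−2}, the following integer identity holds between counts of standard Young tableaux: 3 · ℓ · (ℓ−1) · 2^{2n−4} · (j−1)! · j! · (n−j−2)! · (n−j−1)! · f^{λ_n^{(j)}} = 4 · (2j−1)!! · (2j+1)!! · (2n−2j−3)!! · (2n−2j−1)!! · f^{δ_n}, where λ_n^{(j)} is the partition obtained from the staircase δ_n = (n−1, n−2, …, 2, 1) by decreasing the j-th and (j+1)-st parts each by 1. -/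
open scoped Classical

/-- The staircase `δ_n` with its `j`-th and `(j+1)`-st parts each decreased by `1`. -/
def modifiedStaircase (n j : ℕ) : Multiset ℕ :=
  Multiset.ofList (List.ofFn (fun i : Fin (n - 1) =>
    if i.val + 1 = j ∨ i.val + 1 = j + 1 then n - (i.val + 1) - 1
    else n - (i.val + 1)))

/-- `T` fills the cells of `S` bijectively with `1, …, |S|`, increasing along rows and columns,
and vanishes off `S`. -/
def IsStdFilling (S : Finset (ℕ × ℕ)) (T : ℕ × ℕ → ℕ) : Prop :=
  (∀ p, p ∉ S → T p = 0) ∧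
  (∀ m, 1 ≤ m → m ≤ S.card → ∃! p, p ∈ S ∧ T p = m) ∧
  (∀ i j, (i, j + 1) ∈ S → T (i, j) < T (i, j + 1)) ∧
  (∀ i j, (i + 1, j) ∈ S → T (i, j) < T (i + 1, j))

/-- The cells of `S` whose right and lower neighbours are not in `S`. -/
noncomputable def outerCorners (S : Finset (ℕ × ℕ)) : Finset (ℕ × ℕ) :=
  S.filter fun c => (c.1, c.2 + 1) ∉ S ∧ (c.1 + 1, c.2) ∉ S

theorem IsStdFilling.image_eq {S : Finset (ℕ × ℕ)} {T : ℕ × ℕ → ℕ} (h : IsStdFilling S T) :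
    S.image T = Finset.Icc 1 S.card := by
  symm
  apply Finset.eq_of_subset_of_card_le
  · intro m hm
    rw [Finset.mem_Icc] at hm
    obtain ⟨p, hp, -⟩ := h.2.1 m hm.1 hm.2
    exact Finset.mem_image.2 ⟨p, hp⟩
  · simpa using Finset.card_image_le

theorem IsStdFilling.mem_Icc {S : Finset (ℕ × ℕ)} {T : ℕ × ℕ → ℕ} (h : IsStdFilling S T)
    {p : ℕ × ℕ} (hp : p ∈ S) : 1 ≤ T p ∧ T p ≤ S.card := by
  rw [← Finset.mem_Icc, ← h.image_eq]
  exact Finset.mem_image_of_mem T hp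

theorem IsStdFilling.le_card {S : Finset (ℕ × ℕ)} {T : ℕ × ℕ → ℕ} (h : IsStdFilling S T)
    (p : ℕ × ℕ) : T p ≤ S.card := by
  by_cases hp : p ∈ S
  · exact (h.mem_Icc hp).2
  · simp [h.1 p hp]

theorem IsStdFilling.update_card {S : Finset (ℕ × ℕ)} {c : ℕ × ℕ} (hc : c ∈ outerCorners S)
    {T : ℕ × ℕ → ℕ} (h : IsStdFilling (S.erase c) T) :
    IsStdFilling S (Function.update T c S.card) := by
  obtain ⟨hcS, hright, hdown⟩ := Finset.mem_filter.1 hc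
  have hcard := Finset.card_erase_add_one hcS
  have hlt (p) : T p < S.card := by have := h.le_card p; omega
  refine ⟨fun p hp => ?_, fun m h1 hm => ?_, fun i j hij => ?_, fun i j hij => ?_⟩
  · have : p ≠ c := by rintro rfl; exact hp hcS
    rw [Function.update_of_ne this]
    exact h.1 p (by simp [hp])
  · rcases hm.eq_or_lt with rfl | hm
    · refine ⟨c, by simp [hcS], ?_⟩
      rintro q ⟨-, hq⟩
      by_contra hqc
      rw [Function.update_of_ne hqc] at hq
      exact (hlt q).ne hq
    · obtain ⟨p, ⟨hp, hpm⟩, hu⟩ := h.2.1 m h1 (by omega)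
      refine ⟨p, ⟨Finset.mem_of_mem_erase hp, ?_⟩, ?_⟩
      · rwa [Function.update_of_ne (Finset.ne_of_mem_erase hp)]
      · rintro q ⟨hq, hqm⟩
        have hqc : q ≠ c := by
          rintro rfl
          simp at hqm
          omega
        rw [Function.update_of_ne hqc] at hqm
        exact hu q ⟨Finset.mem_erase.2 ⟨hqc, hq⟩, hqm⟩
  · have hne : (i, j) ≠ c := by rintro rfl; exact hright hij
    rw [Function.update_of_ne hne]
    by_cases hij' : (i, j + 1) = c
    · rw [hij', Function.update_self]
      exact hlt _
    · rw [Function.update_of_ne hij']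
      exact h.2.2.1 i j (Finset.mem_erase.2 ⟨hij', hij⟩)
  · have hne : (i, j) ≠ c := by rintro rfl; exact hdown hij
    rw [Function.update_of_ne hne]
    by_cases hij' : (i + 1, j) = c
    · rw [hij', Function.update_self]
      exact hlt _
    · rw [Function.update_of_ne hij']
      exact h.2.2.2 i j (Finset.mem_erase.2 ⟨hij', hij⟩)

theorem IsStdFilling.mem_outerCorners {S : Finset (ℕ × ℕ)} {T : ℕ × ℕ → ℕ}
    (h : IsStdFilling S T) {c : ℕ × ℕ} (hc : c ∈ S) (hT : T c = S.card) :
    c ∈ outerCorners S := by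
  refine Finset.mem_filter.2 ⟨hc, fun hr => ?_, fun hd => ?_⟩
  · have h1 : T c < _ := h.2.2.1 c.1 c.2 hr
    have := h.le_card (c.1, c.2 + 1)
    omega
  · have h1 : T c < _ := h.2.2.2 c.1 c.2 hd
    have := h.le_card (c.1 + 1, c.2)
    omega

theorem IsStdFilling.update_zero {S : Finset (ℕ × ℕ)} {T : ℕ × ℕ → ℕ}
    (h : IsStdFilling S T) {c : ℕ × ℕ} (hc : c ∈ S) (hT : T c = S.card) :
    IsStdFilling (S.erase c) (Function.update T c 0) := by
  have hcard := Finset.card_erase_add_one hc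
  refine ⟨fun p hp => ?_, fun m h1 hm => ?_, fun i j hij => ?_, fun i j hij => ?_⟩
  · by_cases hpc : p = c
    · simp [hpc]
    · rw [Function.update_of_ne hpc]
      exact h.1 p fun hpS => hp (Finset.mem_erase.2 ⟨hpc, hpS⟩)
  · obtain ⟨p, ⟨hp, hpm⟩, hu⟩ := h.2.1 m h1 (by omega)
    have hpc : p ≠ c := by rintro rfl; omega
    refine ⟨p, ⟨Finset.mem_erase.2 ⟨hpc, hp⟩, by rwa [Function.update_of_ne hpc]⟩, ?_⟩
    rintro q ⟨hq, hqm⟩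
    rw [Function.update_of_ne (Finset.ne_of_mem_erase hq)] at hqm
    exact hu q ⟨Finset.mem_of_mem_erase hq, hqm⟩
  · rw [Function.update_of_ne (Finset.ne_of_mem_erase hij)]
    refine lt_of_le_of_lt ?_ (h.2.2.1 i j (Finset.mem_of_mem_erase hij))
    rw [Function.update_apply]
    split_ifs <;> simp
  · rw [Function.update_of_ne (Finset.ne_of_mem_erase hij)]
    refine lt_of_le_of_lt ?_ (h.2.2.2 i j (Finset.mem_of_mem_erase hij))
    rw [Function.update_apply]
    split_ifs <;> simp

/-- The number of standard fillings of `S`. -/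
noncomputable def stdFillingCount (S : Finset (ℕ × ℕ)) : ℕ := Nat.card {T // IsStdFilling S T}

/-- Deleting the largest entry identifies the standard fillings of a nonempty `S` with the
standard fillings of the sets obtained from `S` by removing an outer corner. -/
noncomputable def stdFillingEquiv {S : Finset (ℕ × ℕ)} (hS : S.Nonempty) :
    (Σ c : outerCorners S, {T // IsStdFilling (S.erase c.1) T}) ≃ {T // IsStdFilling S T} :=
  Equiv.ofBijective (fun x => ⟨Function.update x.2.1 x.1.1 S.card, x.2.2.update_card x.1.2⟩) <| by
    have hpos := hS.card_pos
    constructor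
    · rintro ⟨⟨c, hc⟩, T, hT⟩ ⟨⟨d, hd⟩, U, hU⟩ heq
      have heq : Function.update T c S.card = Function.update U d S.card := congrArg Subtype.val heq
      have hcd : c = d := by
        by_contra hne
        have h1 := congrFun heq c
        rw [Function.update_self, Function.update_of_ne hne] at h1
        have h2 := hU.le_card c
        have := Finset.card_erase_add_one (Finset.mem_filter.1 hd).1
        simp only at h2
        omega
      subst hcd
      have hTU : T = U := by
        funext p
        by_cases hp : p = c
        · rw [hp, hT.1 c (by simp), hU.1 c (by simp)]
        · simpa [Function.update_of_ne hp] using congrFun heq p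
      subst hTU
      rfl
    · rintro ⟨T, hT⟩
      obtain ⟨c, ⟨hc, hcT⟩, -⟩ := hT.2.1 S.card hpos le_rfl
      refine ⟨⟨⟨c, hT.mem_outerCorners hc hcT⟩, _, hT.update_zero hc hcT⟩, Subtype.ext ?_⟩
      simp [← hcT]

theorem isStdFilling_empty_iff {T : ℕ × ℕ → ℕ} : IsStdFilling ∅ T ↔ T = 0 := by
  constructor
  · intro h
    funext p
    exact h.1 p (by simp)
  · rintro rfl
    refine ⟨by simp, fun m h1 hm => ?_, by simp, by simp⟩
    simp at hm
    omega

theorem finite_isStdFilling (S : Finset (ℕ × ℕ)) : Finite {T // IsStdFilling S T} := by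
  induction hN : S.card generalizing S with
  | zero =>
    obtain rfl := Finset.card_eq_zero.1 hN
    simp only [isStdFilling_empty_iff]
    infer_instance
  | succ N ih =>
    have (c : outerCorners S) : Finite {T // IsStdFilling (S.erase c.1) T} := by
      have := Finset.card_erase_add_one (Finset.mem_filter.1 c.2).1
      exact ih _ (by omega)
    exact Finite.of_equiv _ (stdFillingEquiv (Finset.card_pos.1 (by omega)))

theorem stdFillingCount_empty : stdFillingCount ∅ = 1 := by
  simp [stdFillingCount, isStdFilling_empty_iff]

theorem stdFillingCount_eq_sum {S : Finset (ℕ × ℕ)} (hS : S.Nonempty) :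
    stdFillingCount S = ∑ c ∈ outerCorners S, stdFillingCount (S.erase c) := by
  have (c : outerCorners S) := finite_isStdFilling (S.erase c.1)
  rw [stdFillingCount, ← Nat.card_congr (stdFillingEquiv hS), Nat.card_sigma]
  exact Finset.sum_coe_sort (outerCorners S) fun c => stdFillingCount (S.erase c)

open Finset

theorem sum_det_updateRow_mul {r : ℕ} (A : Matrix (Fin r) (Fin r) ℤ) (v d : Fin r → ℤ) :
    ∑ i, (A.updateRow i fun j => (v i - d j) * A i j).det =
      (∑ i, v i - ∑ i, d i) * A.det := by
  simp only [Matrix.det_apply', mul_sum]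
  rw [sum_comm]
  refine sum_congr rfl fun σ _ => ?_
  have key : ∀ i, ∏ k, (A.updateRow i fun j => (v i - d j) * A i j) (σ k) k =
      (v i - d (σ.symm i)) * ∏ k, A (σ k) k := by
    intro i
    rw [← mul_prod_erase univ _ (mem_univ (σ.symm i)),
      ← mul_prod_erase univ (fun k => A (σ k) k) (mem_univ (σ.symm i)), ← mul_assoc]
    congr 1
    · simp
    · refine prod_congr rfl fun k hk => ?_
      rw [Matrix.updateRow_ne]
      rintro rfl
      simp at hk
  simp only [key]
  rw [← Equiv.sum_comp σ.symm d, ← sum_sub_distrib, ← mul_sum, ← sum_mul]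
  ring

theorem sum_mul_det_vandermonde_update {r : ℕ} (v : Fin r → ℤ) :
    ∑ i, v i * (Matrix.vandermonde (Function.update v i (v i - 1))).det =
      (∑ i, v i - ∑ i : Fin r, (i : ℤ)) * (Matrix.vandermonde v).det := by
  have hdet (w : Fin r → ℤ) := Matrix.det_eval_matrixOfPolynomials_eq_det_vandermonde w
    (fun j : Fin r => descPochhammer ℤ j) (fun j => descPochhammer_natDegree ℤ j)
    (fun j => monic_descPochhammer ℤ j)
  simp only [hdet]
  rw [← sum_det_updateRow_mul]
  refine sum_congr rfl fun i _ => ?_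
  have hrow : (Matrix.of fun k (j : Fin r) =>
      (descPochhammer ℤ j).eval (Function.update v i (v i - 1) k)) =
      (Matrix.of fun k (j : Fin r) => (descPochhammer ℤ j).eval (v k)).updateRow i
        fun j => (descPochhammer ℤ j).eval (v i - 1) := by
    ext k j
    by_cases hk : k = i
    · subst hk; simp
    · simp [hk]
  rw [hrow, ← Matrix.det_updateRow_smul]
  congr 2
  funext j
  have h1 := descPochhammer_succ_eval (S := ℤ) j (v i)
  rw [descPochhammer_succ_left] at h1
  simp only [Polynomial.eval_mul, Polynomial.eval_X, Polynomial.eval_comp, Polynomial.eval_sub,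
    Polynomial.eval_one] at h1
  simp only [Pi.smul_apply, smul_eq_mul, Matrix.of_apply]
  rw [h1, mul_comm]

/-- The cells of the diagram whose row lengths, read from the bottom row upwards, are `μ`. -/
def rowCells {r : ℕ} (μ : Fin r → ℕ) : Finset (ℕ × ℕ) :=
  (univ.sigma fun i => range (μ i)).map
    ⟨fun x : (_ : Fin r) × ℕ => ((x.1.rev : ℕ), x.2), by
      rintro ⟨i, a⟩ ⟨k, b⟩ h
      simp only [Prod.mk.injEq, Fin.val_inj, Fin.rev_inj] at h
      obtain ⟨rfl, rfl⟩ := h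
      rfl⟩

theorem card_rowCells {r : ℕ} (μ : Fin r → ℕ) : (rowCells μ).card = ∑ i, μ i := by
  simp [rowCells]

theorem mem_rowCells {r : ℕ} {μ : Fin r → ℕ} {p : ℕ × ℕ} :
    p ∈ rowCells μ ↔ ∃ i : Fin r, (i.rev : ℕ) = p.1 ∧ p.2 < μ i := by
  simp only [rowCells, mem_map, mem_sigma, mem_univ, true_and, mem_range]
  constructor
  · rintro ⟨⟨i, b⟩, hb, rfl⟩
    exact ⟨i, rfl, hb⟩
  · rintro ⟨i, hi, hb⟩
    exact ⟨⟨i, p.2⟩, hb, Prod.ext hi rfl⟩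

theorem rev_mem_rowCells {r : ℕ} {μ : Fin r → ℕ} {i : Fin r} {b : ℕ} :
    ((i.rev : ℕ), b) ∈ rowCells μ ↔ b < μ i := by
  rw [mem_rowCells]
  constructor
  · rintro ⟨k, hk, hb⟩
    rw [Fin.val_inj, Fin.rev_inj] at hk
    rwa [← hk]
  · exact fun hb => ⟨i, rfl, hb⟩

/-- Row `i` can be shortened by one cell: it is nonempty and longer than the preceding row. -/
def Shortenable {r : ℕ} (μ : Fin r → ℕ) (i : Fin r) : Prop :=
  0 < μ i ∧ ∀ k : Fin r, (k : ℕ) + 1 = i → μ k < μ i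

theorem mem_outerCorners_rowCells {r : ℕ} {μ : Fin r → ℕ} (i : Fin r) (b : ℕ) :
    ((i.rev : ℕ), b) ∈ outerCorners (rowCells μ) ↔ Shortenable μ i ∧ b = μ i - 1 := by
  simp only [outerCorners, mem_filter, rev_mem_rowCells, not_lt]
  have hdown : ((i.rev : ℕ) + 1, b) ∉ rowCells μ ↔ ∀ k : Fin r, (k : ℕ) + 1 = i → μ k ≤ b := by
    rw [mem_rowCells]
    push Not
    refine forall_congr' fun k => imp_congr_left ?_
    simp only [Fin.val_rev]
    omega
  rw [hdown, Shortenable]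
  constructor
  · rintro ⟨h1, h2, h3⟩
    refine ⟨⟨by omega, fun k hk => ?_⟩, by omega⟩
    have := h3 k hk
    omega
  · rintro ⟨⟨h1, h2⟩, rfl⟩
    refine ⟨by omega, by omega, fun k hk => ?_⟩
    have := h2 k hk
    omega

theorem rowCells_erase {r : ℕ} {μ : Fin r → ℕ} {i : Fin r} (hi : 0 < μ i) :
    (rowCells μ).erase ((i.rev : ℕ), μ i - 1) =
      rowCells (Function.update μ i (μ i - 1)) := by
  ext p
  rw [mem_erase, mem_rowCells, mem_rowCells]
  constructor
  · rintro ⟨hne, k, hk, hp⟩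
    refine ⟨k, hk, ?_⟩
    by_cases hki : k = i
    · subst hki
      rw [Function.update_self]
      have : p.2 ≠ μ k - 1 := fun h => hne (Prod.ext hk.symm h)
      omega
    · rwa [Function.update_of_ne hki]
  · rintro ⟨k, hk, hp⟩
    by_cases hki : k = i
    · subst hki
      rw [Function.update_self] at hp
      refine ⟨fun h => ?_, k, hk, by omega⟩
      rw [h] at hp
      exact hp.false
    · rw [Function.update_of_ne hki] at hp
      refine ⟨fun h => hki ?_, k, hk, hp⟩
      rw [h, Fin.val_inj, Fin.rev_inj] at hk
      exact hk

theorem stdFillingCount_rowCells {r : ℕ} {μ : Fin r → ℕ} (hμ : 0 < ∑ i, μ i) :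
    stdFillingCount (rowCells μ) = ∑ i with Shortenable μ i,
      stdFillingCount (rowCells (Function.update μ i (μ i - 1))) := by
  rw [stdFillingCount_eq_sum (card_pos.1 (by rwa [card_rowCells]))]
  symm
  refine sum_nbij (fun i => ((i.rev : ℕ), μ i - 1)) (fun i hi => ?_) (fun i _ k _ h => ?_)
    (fun p hp => ?_) fun i hi => ?_
  · exact (mem_outerCorners_rowCells i _).2 ⟨(mem_filter.1 hi).2, rfl⟩
  · exact Fin.rev_inj.1 (Fin.val_inj.1 (congrArg Prod.fst h))
  · obtain ⟨i, hi, -⟩ := mem_rowCells.1 (mem_filter.1 hp).1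
    obtain ⟨a, b⟩ := p
    obtain rfl : (i.rev : ℕ) = a := hi
    obtain ⟨h1, rfl⟩ := (mem_outerCorners_rowCells i b).1 hp
    exact ⟨i, by simpa using h1, rfl⟩
  · rw [rowCells_erase (mem_filter.1 hi).2.1]

theorem Shortenable.monotone_update {r : ℕ} {μ : Fin r → ℕ} (hμ : Monotone μ) {i : Fin r}
    (hi : Shortenable μ i) : Monotone (Function.update μ i (μ i - 1)) := by
  intro a b hab
  have h0 := hμ hab
  simp only [Function.update_apply]
  split_ifs with ha hb hb
  · exact le_rfl
  · subst ha
    omega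
  · subst hb
    have hlt : (a : ℕ) < b := lt_of_le_of_ne hab (Fin.val_ne_of_ne ha)
    have h1 := hi.2 ⟨b - 1, by omega⟩ (Nat.sub_add_cancel (by omega))
    have h2 : μ a ≤ μ ⟨b - 1, by omega⟩ := hμ (Fin.mk_le_mk.2 (by omega))
    omega
  · exact h0

/-- If row `i` cannot be shortened, its term in the branching recursion vanishes. -/
theorem mul_det_vandermonde_update_eq_zero {r : ℕ} {μ : Fin r → ℕ} (hμ : Monotone μ) {i : Fin r}
    (hi : ¬ Shortenable μ i) :
    ((μ i + i : ℕ) : ℤ) * (Matrix.vandermonde (Function.update (fun k => ((μ k + k : ℕ) : ℤ)) i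
      (((μ i + i : ℕ) : ℤ) - 1))).det = 0 := by
  have key : ∀ k : Fin r, (k : ℕ) + 1 = i → μ k = μ i → (Matrix.vandermonde
      (Function.update (fun k => ((μ k + k : ℕ) : ℤ)) i (((μ i + i : ℕ) : ℤ) - 1))).det = 0 := by
    intro k hk hki
    have hne : k ≠ i := by rintro rfl; omega
    refine Matrix.det_zero_of_row_eq hne ?_
    funext j
    simp only [Matrix.vandermonde_apply, Function.update_self, Function.update_of_ne hne]
    rw [← hk, hki]
    push_cast
    ring
  rw [Shortenable] at hi
  by_cases h0 : μ i = 0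
  · rcases Nat.eq_zero_or_pos (i : ℕ) with hi0 | hi0
    · simp [h0, hi0]
    · rw [key ⟨i - 1, by omega⟩ (Nat.sub_add_cancel hi0), mul_zero]
      have : μ ⟨i - 1, by omega⟩ ≤ μ i := hμ (Fin.mk_le_mk.2 (Nat.sub_le _ _))
      omega
  · push Not at hi
    obtain ⟨k, hk, hki⟩ := hi (by omega)
    rw [key k hk (le_antisymm (hμ (Fin.mk_le_mk.2 (by omega))) hki), mul_zero]

theorem prod_factorial_update {r : ℕ} (μ : Fin r → ℕ) {i : Fin r} (hi : 0 < μ i) :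
    ∏ k, (μ k + k).factorial = (μ i + i) *
      ∏ k, (Function.update μ i (μ i - 1) k + k).factorial := by
  rw [← mul_prod_erase univ _ (mem_univ i), ← mul_prod_erase univ
    (fun k => (Function.update μ i (μ i - 1) k + k).factorial) (mem_univ i), ← mul_assoc]
  congr 1
  · rw [Function.update_self, show μ i + (i : ℕ) = μ i - 1 + i + 1 by omega, Nat.factorial_succ]
  · refine prod_congr rfl fun k hk => ?_
    rw [Function.update_of_ne (ne_of_mem_erase hk)]

/-- The determinantal form of the hook length formula. -/
theorem stdFillingCount_mul_prod_factorial {r : ℕ} {μ : Fin r → ℕ} (hμ : Monotone μ) :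
    (stdFillingCount (rowCells μ) : ℤ) * ((∏ i, (μ i + i).factorial : ℕ) : ℤ) =
      ((∑ i, μ i).factorial : ℤ) *
        (Matrix.vandermonde fun i => ((μ i + i : ℕ) : ℤ)).det := by
  induction hN : ∑ i, μ i generalizing μ with
  | zero =>
    have h0 : μ = 0 := by
      funext i
      exact (sum_eq_zero_iff.1 hN) i (mem_univ i)
    have hempty : rowCells μ = ∅ := by rw [← card_eq_zero, card_rowCells, hN]
    rw [hempty, stdFillingCount_empty, h0]
    cases r with
    | zero => simp
    | succ r =>
      simp only [Pi.zero_apply, zero_add]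
      rw [Matrix.det_vandermonde_id_eq_superFactorial, Fin.prod_univ_eq_prod_range,
        Nat.prod_range_succ_factorial]
      simp
  | succ N ih =>
    have hterm : ∀ i, Shortenable μ i →
        (stdFillingCount (rowCells (Function.update μ i (μ i - 1))) : ℤ) *
          ((∏ k, (μ k + k).factorial : ℕ) : ℤ) = (N.factorial : ℤ) * (((μ i + i : ℕ) : ℤ) *
          (Matrix.vandermonde (Function.update (fun k => ((μ k + k : ℕ) : ℤ)) i
            (((μ i + i : ℕ) : ℤ) - 1))).det) := by
      intro i hi
      have hsum : ∑ k, Function.update μ i (μ i - 1) k = N := by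
        rw [sum_update_of_mem (mem_univ i)]
        rw [← add_sum_erase univ _ (mem_univ i)] at hN
        have := hi.1
        rw [← erase_eq]
        omega
      have h := ih (hi.monotone_update hμ) hsum
      have hvec : (fun k => ((Function.update μ i (μ i - 1) k + k : ℕ) : ℤ)) =
          Function.update (fun k => ((μ k + k : ℕ) : ℤ)) i (((μ i + i : ℕ) : ℤ) - 1) := by
        funext k
        by_cases hk : k = i
        · subst hk
          have := hi.1
          simp only [Function.update_self]
          omega
        · simp [hk]
      rw [hvec] at h
      rw [prod_factorial_update μ hi.1, Nat.cast_mul, mul_left_comm, h]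
      ring
    rw [stdFillingCount_rowCells (by omega), Nat.cast_sum, sum_mul,
      sum_congr rfl fun i hi => hterm i (mem_filter.1 hi).2, ← mul_sum,
      sum_filter_of_ne fun i _ hne => by_contra fun hi =>
        hne (mul_det_vandermonde_update_eq_zero hμ hi),
      sum_mul_det_vandermonde_update, Nat.factorial_succ]
    have : ∑ i, ((μ i + i : ℕ) : ℤ) - ∑ i : Fin r, (i : ℤ) = (N + 1 : ℕ) := by
      rw [← hN]
      push_cast
      rw [sum_add_distrib]
      ring
    rw [this]
    push_cast
    ring

theorem lt_card_filter_iff {r : ℕ} {μ : Fin r → ℕ} (hμ : Monotone μ) (a b : ℕ) :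
    a < (univ.filter fun i => b < μ i).card ↔ (a, b) ∈ rowCells μ := by
  by_cases ha : a < r
  · obtain ⟨i, rfl⟩ : ∃ i : Fin r, (i.rev : ℕ) = a := ⟨Fin.rev ⟨a, ha⟩, by simp⟩
    rw [rev_mem_rowCells]
    constructor
    · intro h
      by_contra hb
      refine h.not_ge ?_
      rw [Fin.val_rev, show r - (i + 1) = r - 1 - i by omega, ← Fin.card_Ioi]
      refine card_le_card fun k hk => mem_Ioi.2 (lt_of_not_ge fun hki => hb ?_)
      exact (mem_filter.1 hk).2.trans_le (hμ hki)
    · intro h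
      refine lt_of_lt_of_le ?_ (card_le_card (s := Ici i) fun k hk => ?_)
      · rw [Fin.card_Ici, Fin.val_rev]
        omega
      · exact mem_filter.2 ⟨mem_univ k, h.trans_le (hμ (mem_Ici.1 hk))⟩
  · refine iff_of_false (fun h => ha (h.trans_le ?_)) fun h => ?_
    · simpa using card_le_univ (univ.filter fun i => b < μ i)
    · obtain ⟨i, hi, -⟩ := mem_rowCells.1 h
      exact ha (lt_of_eq_of_lt hi.symm i.rev.isLt)

theorem sytCount_map_univ {r : ℕ} {μ : Fin r → ℕ} (hμ : Monotone μ) :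
    sytCount (univ.val.map μ) = stdFillingCount (rowCells μ) := by
  have hcells : cellsOf (univ.val.map μ) = rowCells μ := by
    ext ⟨a, b⟩
    rw [mem_coe, ← lt_card_filter_iff hμ]
    simp only [cellsOf, Set.mem_ofPred_eq, Multiset.filter_map, Multiset.card_map]
    rfl
  have hsum : (univ.val.map μ).sum = (rowCells μ).card := (card_rowCells μ).symm
  simp only [sytCount, stdFillingCount, IsSYT, IsStdFilling, hcells, hsum, mem_coe]

theorem map_univ_val_fin (f : ℕ → ℕ) (r : ℕ) :
    (univ.val.map fun i : Fin r => f i) = (Multiset.range r).map f := by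
  rw [Fin.univ_val_map, List.ofFn_eq_map, Multiset.range, Multiset.map_coe,
    ← List.map_coe_finRange_eq_range, List.map_map]
  rfl

theorem staircase_eq_map (n : ℕ) :
    staircase n = univ.val.map fun i : Fin (n - 1) => (i : ℕ) + 1 := by
  rw [map_univ_val_fin fun i => i + 1]
  rfl

/-- The rows of `modifiedStaircase (a + c + 3) (c + 1)`, from the bottom row upwards. -/
def shortenedRow (a i : ℕ) : ℕ := if i = a ∨ i = a + 1 then i else i + 1

theorem modifiedStaircase_eq_map (a c : ℕ) :
    modifiedStaircase (a + c + 3) (c + 1) =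
      univ.val.map fun i : Fin (a + 2 + c) => shortenedRow a i := by
  rw [map_univ_val_fin, show a + 2 + c = a + c + 3 - 1 by omega, ← map_univ_val_fin,
    ← Multiset.map_univ_val_equiv Fin.revPerm, Multiset.map_map, Fin.univ_val_map,
    modifiedStaircase]
  congr 2
  funext i
  simp only [Function.comp_apply, Fin.revPerm_apply, Fin.val_rev, shortenedRow]
  split_ifs <;> omega

theorem monotone_shortenedRow (a : ℕ) : Monotone (shortenedRow a) := by
  intro i k hik
  simp only [shortenedRow]
  split_ifs <;> omega

/-- The Vandermonde product of the first `r` terms of a sequence. -/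
def vandermondeProd (l : ℕ → ℤ) (r : ℕ) : ℤ := ∏ k ∈ range r, ∏ i ∈ range k, (l k - l i)

theorem vandermondeProd_succ (l : ℕ → ℤ) (r : ℕ) :
    vandermondeProd l (r + 1) = vandermondeProd l r * ∏ i ∈ range r, (l r - l i) :=
  prod_range_succ _ _

theorem vandermondeProd_congr {l l' : ℕ → ℤ} {r : ℕ} (h : ∀ i < r, l i = l' i) :
    vandermondeProd l r = vandermondeProd l' r := by
  refine prod_congr rfl fun k hk => prod_congr rfl fun i hi => ?_
  rw [mem_range] at hk hi
  rw [h k hk, h i (hi.trans hk)]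

theorem det_vandermonde_eq_vandermondeProd (l : ℕ → ℤ) (r : ℕ) :
    (Matrix.vandermonde fun i : Fin r => l i).det = vandermondeProd l r := by
  rw [Matrix.det_vandermonde, vandermondeProd, ← Fin.prod_univ_eq_prod_range
    (fun k => ∏ i ∈ range k, (l k - l i)), prod_comm' (t' := univ) (s' := fun k => Iio k) (by simp)]
  refine prod_congr rfl fun k _ => ?_
  rw [← Nat.Iio_eq_range, ← Fin.map_valEmbedding_Iio, prod_map]
  rfl

theorem prod_range_eq_of_reflect {f g : ℕ → ℤ} {a : ℕ} (s : ℤ)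
    (hf : ∀ i < a, f i = 2 * a - 2 * i + s) (hg : ∀ i, g i = 2 * i + 2 + s) :
    ∏ i ∈ range a, f i = ∏ i ∈ range a, g i := by
  rw [← prod_range_reflect]
  refine prod_congr rfl fun i hi => ?_
  have := mem_range.1 hi
  rw [hf _ (by omega), hg, show a - 1 - i = a - (i + 1) by omega, Nat.cast_sub this]
  push_cast
  ring

theorem prod_two_mul_add_one (a : ℕ) :
    ∏ i ∈ range a, (2 * i + 1 : ℤ) = (2 * a - 1).doubleFactorial := by
  induction a with
  | zero => simp
  | succ a ih =>
    rw [prod_range_succ, ih, show 2 * (a + 1) - 1 = 2 * a + 1 by omega, Nat.doubleFactorial_add_one]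
    push_cast
    ring

theorem prod_two_mul_add_three (a : ℕ) :
    ∏ i ∈ range a, (2 * i + 3 : ℤ) = (2 * a + 1).doubleFactorial := by
  induction a with
  | zero => simp
  | succ a ih =>
    rw [prod_range_succ, ih, show 2 * (a + 1) + 1 = 2 * a + 1 + 2 by omega,
      Nat.doubleFactorial_add_two]
    push_cast
    ring

theorem prod_two_mul_add_two (a : ℕ) :
    ∏ i ∈ range a, (2 * i + 2 : ℤ) = 2 ^ a * a.factorial := by
  induction a with
  | zero => simp
  | succ a ih =>
    rw [prod_range_succ, ih, Nat.factorial_succ]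
    push_cast
    ring

theorem prod_two_mul_add_four (a : ℕ) :
    ∏ i ∈ range a, (2 * i + 4 : ℤ) = 2 ^ a * (a + 1).factorial := by
  induction a with
  | zero => simp
  | succ a ih =>
    rw [prod_range_succ, ih, Nat.factorial_succ (a + 1)]
    push_cast
    ring

theorem shortenedRow_self (a : ℕ) : shortenedRow a a = a := by simp [shortenedRow]

theorem shortenedRow_succ_self (a : ℕ) : shortenedRow a (a + 1) = a + 1 := by simp [shortenedRow]

theorem shortenedRow_of_lt {a i : ℕ} (h : i < a) : shortenedRow a i = i + 1 := by
  rw [shortenedRow, if_neg (by omega)]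

theorem shortenedRow_add (a i : ℕ) : shortenedRow a (a + 2 + i) = a + 2 + i + 1 := by
  rw [shortenedRow, if_neg (by omega)]

theorem vandermondeProd_shortenedRow_add_two (a : ℕ) :
    vandermondeProd (fun i => ((shortenedRow a i + i : ℕ) : ℤ)) (a + 2) *
      (2 ^ (2 * a) * a.factorial * (a + 1).factorial) =
    vandermondeProd (fun i => ((i + 1 + i : ℕ) : ℤ)) (a + 2) *
      ((2 * a - 1).doubleFactorial * (2 * a + 1).doubleFactorial) := by
  have hV : vandermondeProd (fun i => ((shortenedRow a i + i : ℕ) : ℤ)) a =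
      vandermondeProd (fun i => ((i + 1 + i : ℕ) : ℤ)) a :=
    vandermondeProd_congr fun i hi => by rw [shortenedRow_of_lt hi]
  have h1 : ∏ i ∈ range a, (((a + a : ℕ) : ℤ) - ((shortenedRow a i + i : ℕ) : ℤ)) =
      (2 * a - 1).doubleFactorial := by
    rw [← prod_two_mul_add_one]
    exact prod_range_eq_of_reflect (-1)
      (fun i hi => by rw [shortenedRow_of_lt hi]; push_cast; ring) fun i => by ring
  have h2 : ∏ i ∈ range a, (((a + 1 + (a + 1) : ℕ) : ℤ) - ((shortenedRow a i + i : ℕ) : ℤ)) =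
      (2 * a + 1).doubleFactorial := by
    rw [← prod_two_mul_add_three]
    exact prod_range_eq_of_reflect 1
      (fun i hi => by rw [shortenedRow_of_lt hi]; push_cast; ring) fun i => by ring
  have h3 : ∏ i ∈ range a, (((a + 1 + a : ℕ) : ℤ) - ((i + 1 + i : ℕ) : ℤ)) =
      2 ^ a * a.factorial := by
    rw [← prod_two_mul_add_two]
    exact prod_range_eq_of_reflect 0
      (fun i _ => by push_cast; ring) fun i => by ring
  have h4 : ∏ i ∈ range a, (((a + 1 + 1 + (a + 1) : ℕ) : ℤ) - ((i + 1 + i : ℕ) : ℤ)) =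
      2 ^ a * (a + 1).factorial := by
    rw [← prod_two_mul_add_four]
    exact prod_range_eq_of_reflect 2
      (fun i _ => by push_cast; ring) fun i => by ring
  simp only [vandermondeProd_succ, prod_range_succ, shortenedRow_self, shortenedRow_succ_self,
    hV, h1, h2, h3, h4]
  push_cast
  ring

theorem vandermondeProd_shortenedRow (a c : ℕ) :
    vandermondeProd (fun i => ((shortenedRow a i + i : ℕ) : ℤ)) (a + 2 + c) *
      (3 * 2 ^ (2 * a + 2 * c) * a.factorial * (a + 1).factorial * c.factorial *
        (c + 1).factorial) =
    vandermondeProd (fun i => ((i + 1 + i : ℕ) : ℤ)) (a + 2 + c) *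
      ((2 * a - 1).doubleFactorial * (2 * a + 1).doubleFactorial *
        (2 * c + 1).doubleFactorial * (2 * c + 3).doubleFactorial) := by
  induction c with
  | zero =>
    have := vandermondeProd_shortenedRow_add_two a
    simp only [add_zero, mul_zero, zero_add, Nat.factorial_zero, Nat.factorial_one, Nat.cast_one,
      Nat.doubleFactorial, mul_one]
    linear_combination 3 * this
  | succ c ih =>
    have hstep : (∏ i ∈ range (a + 2 + c), (((shortenedRow a (a + 2 + c) + (a + 2 + c) : ℕ) : ℤ) -
          ((shortenedRow a i + i : ℕ) : ℤ))) * ((2 * c + 2) * (2 * c + 4)) =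
        (∏ i ∈ range (a + 2 + c), (((a + 2 + c + 1 + (a + 2 + c) : ℕ) : ℤ) -
          ((i + 1 + i : ℕ) : ℤ))) * ((2 * c + 3) * (2 * c + 5)) := by
      simp only [prod_range_add _ (a + 2) c, prod_range_succ, shortenedRow_self,
        shortenedRow_succ_self, shortenedRow_add]
      rw [prod_congr rfl fun i hi => by rw [shortenedRow_of_lt (mem_range.1 hi)]]
      push_cast
      ring
    rw [← add_assoc, show 2 * (c + 1) + 1 = 2 * c + 1 + 2 by ring,
      show 2 * (c + 1) + 3 = 2 * c + 3 + 2 by ring, Nat.doubleFactorial_add_two (2 * c + 1),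
      Nat.doubleFactorial_add_two (2 * c + 3), Nat.factorial_succ (c + 1)]
    simp only [vandermondeProd_succ]
    generalize ∏ i ∈ range (a + 2 + c), (((shortenedRow a (a + 2 + c) + (a + 2 + c) : ℕ) : ℤ) -
      ((shortenedRow a i + i : ℕ) : ℤ)) = P at hstep ⊢
    generalize ∏ i ∈ range (a + 2 + c), (((a + 2 + c + 1 + (a + 2 + c) : ℕ) : ℤ) -
      ((i + 1 + i : ℕ) : ℤ)) = Q at hstep ⊢
    generalize vandermondeProd _ _ = V at ih ⊢
    generalize vandermondeProd _ _ = W at ih ⊢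
    rw [Nat.factorial_succ c] at ih ⊢
    push_cast at ih ⊢
    linear_combination P * (2 * c + 2) * (2 * c + 4) * ih + W * ((2 * a - 1).doubleFactorial *
      (2 * a + 1).doubleFactorial * (2 * c + 1).doubleFactorial *
        (2 * c + 3).doubleFactorial) * hstep

theorem prod_factorial_shortenedRow (a c : ℕ) :
    ∏ i ∈ range (a + 2 + c), (i + 1 + i).factorial = (2 * a + 1) * (2 * a + 3) *
      ∏ i ∈ range (a + 2 + c), (shortenedRow a i + i).factorial := by
  simp only [prod_range_add _ (a + 2) c, prod_range_succ, shortenedRow_self,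
    shortenedRow_succ_self, shortenedRow_add]
  rw [prod_congr rfl fun i hi => by rw [← shortenedRow_of_lt (mem_range.1 hi)],
    show a + 1 + a = a + a + 1 by ring, Nat.factorial_succ (a + a),
    show a + 1 + 1 + (a + 1) = a + 1 + (a + 1) + 1 by ring, Nat.factorial_succ (a + 1 + (a + 1))]
  ring

theorem sum_shortenedRow (a c : ℕ) :
    ∑ i ∈ range (a + 2 + c), (i + 1) = ∑ i ∈ range (a + 2 + c), shortenedRow a i + 2 := by
  simp only [sum_range_add _ (a + 2) c, sum_range_succ, shortenedRow_self,
    shortenedRow_succ_self, shortenedRow_add]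
  rw [sum_congr rfl fun i hi => by rw [← shortenedRow_of_lt (mem_range.1 hi)]]
  ring

/-- The hook-length computation: `3·ℓ·(ℓ-1)·2^(2n-4)·(j-1)!·j!·(n-j-2)!·(n-j-1)!·f^(λ_n^(j))
= 4·(2j-1)‼·(2j+1)‼·(2n-2j-3)‼·(2n-2j-1)‼·f^(δ_n)`. -/
theorem hook_length_ratio (n : ℕ) (hn : 3 ≤ n) (ℓ : ℕ) (hℓ : ℓ = n * (n - 1) / 2)
    (j : ℕ) (hj1 : 1 ≤ j) (hj2 : j ≤ n - 2) :
    3 * ℓ * (ℓ - 1) * 2 ^ (2 * n - 4) * (j - 1).factorial * j.factorial *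
        (n - j - 2).factorial * (n - j - 1).factorial * sytCount (modifiedStaircase n j) =
      4 * (2 * j - 1).doubleFactorial * (2 * j + 1).doubleFactorial *
        (2 * n - 2 * j - 3).doubleFactorial * (2 * n - 2 * j - 1).doubleFactorial *
        sytCount (staircase n) := by
  obtain ⟨c, rfl⟩ : ∃ c, j = c + 1 := ⟨j - 1, by omega⟩
  obtain ⟨a, rfl⟩ : ∃ a, n = a + c + 3 := ⟨n - c - 3, by omega⟩
  have hmono : Monotone fun i : Fin (a + 2 + c) => (i : ℕ) + 1 := fun _ _ h =>
    Nat.succ_le_succ h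
  have hmono' : Monotone fun i : Fin (a + 2 + c) => shortenedRow a i := fun _ _ h =>
    monotone_shortenedRow a h
  have hf := stdFillingCount_mul_prod_factorial hmono
  have hf' := stdFillingCount_mul_prod_factorial hmono'
  have hstair : staircase (a + c + 3) =
      univ.val.map fun i : Fin (a + 2 + c) => (i : ℕ) + 1 := by
    rw [staircase_eq_map, map_univ_val_fin (· + 1), map_univ_val_fin (· + 1),
      show a + c + 3 - 1 = a + 2 + c by omega]
  rw [← sytCount_map_univ hmono, ← hstair,
    Fin.prod_univ_eq_prod_range (fun i => (i + 1 + i).factorial),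
    Fin.sum_univ_eq_sum_range (· + 1),
    det_vandermonde_eq_vandermondeProd (fun i => ((i + 1 + i : ℕ) : ℤ)),
    prod_factorial_shortenedRow, sum_shortenedRow] at hf
  rw [← sytCount_map_univ hmono', ← modifiedStaircase_eq_map,
    Fin.prod_univ_eq_prod_range (fun i => (shortenedRow a i + i).factorial),
    Fin.sum_univ_eq_sum_range (shortenedRow a),
    det_vandermonde_eq_vandermondeProd (fun i => ((shortenedRow a i + i : ℕ) : ℤ))] at hf'
  have hsum : ℓ = ∑ i ∈ range (a + 2 + c), shortenedRow a i + 2 := by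
    rw [hℓ, ← sum_shortenedRow, ← sum_range_id, show a + c + 3 = a + 2 + c + 1 by ring,
      sum_range_succ', add_zero]
  have hV := vandermondeProd_shortenedRow a c
  have hF : ∏ i ∈ range (a + 2 + c), (shortenedRow a i + i).factorial ≠ 0 :=
    prod_ne_zero_iff.2 fun i _ => Nat.factorial_ne_zero _
  generalize ∏ i ∈ range (a + 2 + c), (shortenedRow a i + i).factorial = F at hf hf' hF
  generalize ∑ i ∈ range (a + 2 + c), shortenedRow a i = s at hf hf' hsum
  subst hsum
  rw [show s + 2 - 1 = s + 1 by omega, show 2 * (a + c + 3) - 4 = 2 * a + 2 * c + 2 by omega,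
    show a + c + 3 - (c + 1) - 2 = a by omega, show a + c + 3 - (c + 1) - 1 = a + 1 by omega,
    show 2 * (c + 1) - 1 = 2 * c + 1 by omega, show 2 * (c + 1) + 1 = 2 * c + 3 by omega,
    show 2 * (a + c + 3) - 2 * (c + 1) - 3 = 2 * a + 1 by omega,
    show 2 * (a + c + 3) - 2 * (c + 1) - 1 = 2 * a + 1 + 2 by omega,
    show c + 1 - 1 = c by omega, Nat.doubleFactorial_add_two (2 * a + 1)]
  rw [show (2 * a + 1).doubleFactorial = (2 * a + 1) * (2 * a - 1).doubleFactorial from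
    Nat.doubleFactorial_add_one (2 * a)] at hV ⊢
  rw [show (s + 2).factorial = (s + 2) * ((s + 1) * s.factorial) from rfl] at hf
  refine Nat.eq_of_mul_eq_mul_right (Nat.pos_of_ne_zero hF) ?_
  zify
  push_cast at hf hf' hV
  linear_combination (12 * (s + 2) * (s + 1) * 2 ^ (2 * a + 2 * c) * c.factorial *
      (c + 1).factorial * a.factorial * (a + 1).factorial) * hf' +
    (4 * (s + 2) * (s + 1) * s.factorial) * hV -
    (4 * (2 * c + 1).doubleFactorial * (2 * c + 3).doubleFactorial *
      ((2 * a + 1) * (2 * a - 1).doubleFactorial) * (2 * a - 1).doubleFactorial) * hf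
end
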